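/- arXiv:1011.0672 — 4 statements merged into one kernel-verified Lean document; each statement's English description precedes it below -/
import Mathlib

section
/- Let p ∈ ℤ[x] be a polynomial of degree d ≥ 1 and let E = {p(n) : n ∈ ℤ}. Then D(E) = 1/d and 0 < H_{1/d}(E) < ∞; in particular E is regular. -/
open Filter MeasureTheory
open scoped ENNReal

noncomputable section

/-- The filter of intervals `(M, N]` of `ℤ` as the length `N - M` tends to infinity.
An interval is encoded by the pair `(M, N)`. -/
def intervalFilter : Filter (ℤ × ℤ) :=
  Filter.comap (fun p : ℤ × ℤ => p.2 - p.1) Filter.atTop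

/-- The number of elements of `E` in the interval `(M, N]`. -/
def icount (E : Set ℤ) (M N : ℤ) : ℕ := (E ∩ Set.Ioc M N).ncard

/-- The counting dimension of `E ⊆ ℤ`:
`D(E) = limsup_{|I| → ∞} log |E ∩ I| / log |I|`. -/
def countingDim (E : Set ℤ) : ℝ :=
  Filter.limsup
    (fun p : ℤ × ℤ => Real.log (icount E p.1 p.2) / Real.log ((p.2 - p.1 : ℤ) : ℝ))
    intervalFilter

/-- The counting `α`-measure of `E ⊆ ℤ`:
`H_α(E) = limsup_{|I| → ∞} |E ∩ I| / |I|^α`, with values in `[0, ∞]`. -/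
def countingMeasure (α : ℝ) (E : Set ℤ) : ℝ≥0∞ :=
  Filter.limsup
    (fun p : ℤ × ℤ =>
      ENNReal.ofReal ((icount E p.1 p.2 : ℝ) / ((p.2 - p.1 : ℤ) : ℝ) ^ α))
    intervalFilter

/-- The upper-Banach density of `E ⊆ ℤ`:
`d*(E) = limsup_{|I| → ∞} |E ∩ I| / |I|`. -/
def upperBanach (E : Set ℤ) : ℝ :=
  Filter.limsup
    (fun p : ℤ × ℤ => (icount E p.1 p.2 : ℝ) / ((p.2 - p.1 : ℤ) : ℝ))
    intervalFilter

/-- `E ⊆ ℤ` is regular if `0 < H_{D(E)}(E) < ∞`. -/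
def Regular (E : Set ℤ) : Prop :=
  0 < countingMeasure (countingDim E) E ∧ countingMeasure (countingDim E) E < ⊤

/-- Two (regular) sets `E, F ⊆ ℤ` are compatible if there are sequences of intervals
`I_n = (a n, b n]`, `J_n = (c n, d n]` with increasing lengths, `|I_n| ≍ |J_n|`,
`|E ∩ I_n| ≫ |I_n|^{D(E)}` and `|F ∩ J_n| ≫ |J_n|^{D(F)}`. -/
def Compatible (E F : Set ℤ) : Prop :=
  ∃ a b c d : ℕ → ℤ,
    (∀ n, a n < b n) ∧ (∀ n, c n < d n) ∧
    StrictMono (fun n => b n - a n) ∧ StrictMono (fun n => d n - c n) ∧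
    (∃ C : ℝ, 0 < C ∧ ∀ n,
      ((b n - a n : ℤ) : ℝ) ≤ C * ((d n - c n : ℤ) : ℝ) ∧
      ((d n - c n : ℤ) : ℝ) ≤ C * ((b n - a n : ℤ) : ℝ)) ∧
    (∃ c₁ : ℝ, 0 < c₁ ∧ ∀ n,
      c₁ * ((b n - a n : ℤ) : ℝ) ^ countingDim E ≤ (icount E (a n) (b n) : ℝ)) ∧
    (∃ c₂ : ℝ, 0 < c₂ ∧ ∀ n,
      c₂ * ((d n - c n : ℤ) : ℝ) ^ countingDim F ≤ (icount F (c n) (d n) : ℝ))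

/-- The arithmetic sum `E + ⌊λ F⌋ = {a + ⌊λ b⌋ : a ∈ E, b ∈ F}`. -/
def sumFloor (E F : Set ℤ) (l : ℝ) : Set ℤ :=
  {n : ℤ | ∃ a ∈ E, ∃ b ∈ F, n = a + ⌊l * (b : ℝ)⌋}

/-- The length of an interval tends to infinity along `intervalFilter`. -/
theorem tendsto_length_intervalFilter :
    Tendsto (fun q : ℤ × ℤ => ((q.2 - q.1 : ℤ) : ℝ)) intervalFilter atTop :=
  tendsto_intCast_atTop_atTop.comp tendsto_comap

theorem countingDim_eq_of_bounds {E : Set ℤ} {α C c : ℝ} (hα : 0 ≤ α) (hc : 0 < c)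
    (hub : ∀ M N : ℤ, M < N → (icount E M N : ℝ) ≤ C * ((N - M : ℤ) : ℝ) ^ α)
    (hlb : ∃ᶠ q in intervalFilter,
      c * ((q.2 - q.1 : ℤ) : ℝ) ^ α ≤ (icount E q.1 q.2 : ℝ)) :
    countingDim E = α := by
  have hlen := tendsto_length_intervalFilter
  have hlog := Real.tendsto_log_atTop.comp hlen
  have hlim : ∀ b : ℝ, Tendsto
      (fun q : ℤ × ℤ => Real.log b / Real.log ((q.2 - q.1 : ℤ) : ℝ) + α)
      intervalFilter (nhds α) := fun b => by
    simpa using (hlog.const_div_atTop (Real.log b)).add_const α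
  have hupper : ∀ ε > 0, ∀ᶠ q : ℤ × ℤ in intervalFilter,
      Real.log (icount E q.1 q.2) / Real.log ((q.2 - q.1 : ℤ) : ℝ) ≤ α + ε := by
    intro ε hε
    filter_upwards [(hlim (max C 1)).eventually (eventually_le_nhds (lt_add_of_pos_right α hε)),
      hlen.eventually_gt_atTop 1] with q hq hL
    refine le_trans ?_ hq
    have hlogL : 0 < Real.log ((q.2 - q.1 : ℤ) : ℝ) := Real.log_pos hL
    have hL0 : (0 : ℝ) < ((q.2 - q.1 : ℤ) : ℝ) := by linarith
    have hC : (0 : ℝ) < max C 1 := lt_max_of_lt_right one_pos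
    rcases Nat.eq_zero_or_pos (icount E q.1 q.2) with h0 | h0
    · have := Real.log_nonneg (le_max_right C 1)
      rw [h0]
      simp only [Nat.cast_zero, Real.log_zero, zero_div]
      positivity
    · have hlt : q.1 < q.2 := by
        have : (0 : ℤ) < q.2 - q.1 := by exact_mod_cast hL0
        linarith
      have h1 : (icount E q.1 q.2 : ℝ) ≤ max C 1 * ((q.2 - q.1 : ℤ) : ℝ) ^ α :=
        (hub _ _ hlt).trans (by gcongr; exact le_max_left _ _)
      have h2 := Real.log_le_log (by exact_mod_cast h0) h1
      rw [Real.log_mul hC.ne' (by positivity), Real.log_rpow hL0] at h2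
      rw [div_le_iff₀ hlogL, add_mul, div_mul_cancel₀ _ hlogL.ne']
      exact h2
  have hlower : ∀ ε > 0, ∃ᶠ q : ℤ × ℤ in intervalFilter,
      α - ε ≤ Real.log (icount E q.1 q.2) / Real.log ((q.2 - q.1 : ℤ) : ℝ) := by
    intro ε hε
    refine (hlb.and_eventually (((hlim c).eventually
      (eventually_ge_nhds (sub_lt_self α hε))).and (hlen.eventually_gt_atTop 1))).mono ?_
    rintro q ⟨h1, hq, hL⟩
    refine hq.trans ?_
    have hlogL : 0 < Real.log ((q.2 - q.1 : ℤ) : ℝ) := Real.log_pos hL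
    have hL0 : (0 : ℝ) < ((q.2 - q.1 : ℤ) : ℝ) := by linarith
    have h2 := Real.log_le_log (by positivity) h1
    rw [Real.log_mul hc.ne' (by positivity), Real.log_rpow hL0] at h2
    rw [le_div_iff₀ hlogL, add_mul, div_mul_cancel₀ _ hlogL.ne']
    exact h2
  apply le_antisymm
  · refine le_of_forall_pos_le_add fun ε hε => ?_
    exact limsup_le_of_le (IsCoboundedUnder.of_frequently_ge (hlower 1 one_pos)) (hupper ε hε)
  · refine le_of_forall_pos_le_add fun ε hε => ?_
    rw [← sub_le_iff_le_add]
    exact le_limsup_of_frequently_le (hlower ε hε) ⟨α + 1, hupper 1 one_pos⟩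

theorem countingMeasure_lt_top_of_bound {E : Set ℤ} {α C : ℝ}
    (hub : ∀ M N : ℤ, M < N → (icount E M N : ℝ) ≤ C * ((N - M : ℤ) : ℝ) ^ α) :
    countingMeasure α E < ⊤ := by
  refine lt_of_le_of_lt (b := ENNReal.ofReal C) ?_ ENNReal.ofReal_lt_top
  refine limsup_le_of_le (by isBoundedDefault) ?_
  filter_upwards [tendsto_length_intervalFilter.eventually_gt_atTop 0] with q hL
  have hlt : q.1 < q.2 := by
    have : (0 : ℤ) < q.2 - q.1 := by exact_mod_cast hL
    linarith
  apply ENNReal.ofReal_le_ofReal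
  rw [div_le_iff₀ (by positivity)]
  exact hub _ _ hlt

theorem countingMeasure_pos_of_frequently {E : Set ℤ} {α c : ℝ} (hc : 0 < c)
    (hlb : ∃ᶠ q in intervalFilter,
      c * ((q.2 - q.1 : ℤ) : ℝ) ^ α ≤ (icount E q.1 q.2 : ℝ)) :
    0 < countingMeasure α E := by
  refine lt_of_lt_of_le (ENNReal.ofReal_pos.2 hc) (le_limsup_of_frequently_le' ?_)
  refine (hlb.and_eventually
    (tendsto_length_intervalFilter.eventually_gt_atTop 0)).mono ?_
  rintro q ⟨h, hL⟩
  apply ENNReal.ofReal_le_ofReal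
  rwa [le_div_iff₀ (by positivity)]

/-- If a nonconstant integer polynomial of degree `d` takes values in an interval of length `L`
at `d + 1` points which are pairwise at distance at least `m`, then `m ^ d ≤ (d + 1) * L`. -/
theorem pow_le_of_eval_mem_Ioc {p : Polynomial ℤ} {d : ℕ} (hd : p.natDegree = d) (hp : 1 ≤ d)
    {M N : ℤ} {m : ℕ} (hm : 1 ≤ m) (v : Fin (d + 1) → ℤ)
    (hv : ∀ i j, i ≠ j → (m : ℤ) ≤ |v i - v j|) (hmem : ∀ i, p.eval (v i) ∈ Set.Ioc M N) :
    (m : ℝ) ^ d ≤ (d + 1) * ((N - M : ℤ) : ℝ) := by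
  have hm0 : (0 : ℝ) < m := by exact_mod_cast hm
  have hinj : Set.InjOn (fun i => (v i : ℝ)) (Finset.univ : Finset (Fin (d + 1))) := by
    intro i _ j _ hij
    by_contra hne
    have h := hv i j hne
    have : v i = v j := Int.cast_injective hij
    rw [this, sub_self, abs_zero] at h
    omega
  set P : Polynomial ℝ := (p - Polynomial.C M).map (Int.castRingHom ℝ) with hP
  have hdeg : P.degree < (Finset.univ : Finset (Fin (d + 1))).card := by
    rw [Finset.card_univ, Fintype.card_fin]
    refine lt_of_le_of_lt Polynomial.degree_map_le ?_
    refine lt_of_le_of_lt (Polynomial.degree_le_natDegree) ?_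
    rw [Polynomial.natDegree_sub_C, hd]
    exact_mod_cast Nat.lt_succ_self _
  have hsum := Lagrange.coeff_eq_sum hinj hdeg
  have hcoeff : P.coeff d = (p.leadingCoeff : ℝ) := by
    have : d ≠ 0 := by omega
    rw [hP, Polynomial.coeff_map, Polynomial.coeff_sub, Polynomial.coeff_C_of_ne_zero this, sub_zero, Polynomial.leadingCoeff, hd]
    rfl
  have hlead : (1 : ℝ) ≤ |(p.leadingCoeff : ℝ)| := by
    have h0 : p ≠ 0 := by
      rintro rfl
      rw [Polynomial.natDegree_zero] at hd
      omega
    exact_mod_cast Int.one_le_abs (Polynomial.leadingCoeff_ne_zero.2 h0)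
  rw [Finset.card_univ, Fintype.card_fin, Nat.add_sub_cancel, hcoeff] at hsum
  have hterm : ∀ i : Fin (d + 1), |P.eval (v i : ℝ) /
      ∏ j ∈ Finset.univ.erase i, ((v i : ℝ) - v j)| ≤ ((N - M : ℤ) : ℝ) / (m : ℝ) ^ d := by
    intro i
    have hev : P.eval (v i : ℝ) = ((p.eval (v i) - M : ℤ) : ℝ) := by
      rw [hP, Polynomial.eval_intCast_map]
      simp
    have hmi := hmem i
    rw [abs_div, Finset.abs_prod]
    have h1 : |P.eval (v i : ℝ)| ≤ ((N - M : ℤ) : ℝ) := by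
      rw [hev, ← Int.cast_abs]
      have : |p.eval (v i) - M| ≤ N - M := by
        rw [abs_of_pos (by linarith [hmi.1])]
        linarith [hmi.2]
      exact_mod_cast this
    have h2 : (m : ℝ) ^ d ≤ ∏ j ∈ Finset.univ.erase i, |(v i : ℝ) - v j| := by
      have hcard : (Finset.univ.erase i).card = d := by simp
      calc (m : ℝ) ^ d = ∏ j ∈ Finset.univ.erase i, (m : ℝ) := by
            rw [Finset.prod_const, hcard]
        _ ≤ _ := by
            refine Finset.prod_le_prod (fun _ _ => hm0.le) fun j hj => ?_
            exact_mod_cast hv i j (Finset.ne_of_mem_erase hj).symm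
    gcongr
    exact (abs_nonneg _).trans h1
  have hfin : (1 : ℝ) ≤ (d + 1) * (((N - M : ℤ) : ℝ) / (m : ℝ) ^ d) := by
    refine hlead.trans ?_
    rw [hsum]
    refine (Finset.abs_sum_le_sum_abs _ _).trans ((Finset.sum_le_sum fun i _ => hterm i).trans ?_)
    simp
  rwa [← mul_div_assoc, one_le_div (by positivity)] at hfin

/-- Two values of an increasing enumeration of integers are at least as far apart as their
indices. -/
theorem sub_le_sub_of_strictMono {k : ℕ} {f : Fin k → ℤ} (hf : StrictMono f) {i j : Fin k}
    (hij : i ≤ j) : (j : ℤ) - i ≤ f j - f i := by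
  have hmono : Monotone fun a : Fin k => f a - (a : ℤ) := by
    cases k with
    | zero => exact fun a => a.elim0
    | succ k =>
      refine Fin.monotone_iff_le_succ.2 fun a => ?_
      have := hf (Fin.castSucc_lt_succ (i := a))
      simp only [Fin.val_castSucc, Fin.val_succ, Nat.cast_add, Nat.cast_one]
      omega
  have := hmono hij
  simp only at this
  linarith

theorem icount_range_eval_le {p : Polynomial ℤ} (hp : 1 ≤ p.natDegree) {M N : ℤ} (hMN : M < N) :
    (icount (Set.range fun n : ℤ => p.eval n) M N : ℝ) ≤
      2 * p.natDegree * ((p.natDegree : ℝ) + 1) ^ (1 / (p.natDegree : ℝ)) *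
        ((N - M : ℤ) : ℝ) ^ (1 / (p.natDegree : ℝ)) := by
  classical
  set d := p.natDegree with hd
  have hL : (1 : ℝ) ≤ ((N - M : ℤ) : ℝ) := by exact_mod_cast (by omega : (1 : ℤ) ≤ N - M)
  rw [mul_assoc, ← Real.mul_rpow (by positivity) (by positivity)]
  set X : ℝ := ((d : ℝ) + 1) * ((N - M : ℤ) : ℝ) with hX
  have hX1 : 1 ≤ X := by
    have : (0 : ℝ) ≤ d := Nat.cast_nonneg d
    nlinarith
  obtain ⟨T, hTcard, hT⟩ : ∃ T : Finset ℤ,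
      T.card = icount (Set.range fun n : ℤ => p.eval n) M N ∧
        ∀ x ∈ T, p.eval x ∈ Set.Ioc M N := by
    set S := (Set.range fun n : ℤ => p.eval n) ∩ Set.Ioc M N with hS
    have hSfin : S.Finite := (Set.finite_Ioc M N).subset Set.inter_subset_right
    have hch : ∀ y : S, ∃ n : ℤ, p.eval n = y := fun y => y.2.1
    choose g hg using hch
    have hginj : Function.Injective g := fun a b hab => by
      apply Subtype.ext
      rw [← hg a, ← hg b, hab]
    have := hSfin.fintype
    refine ⟨Finset.univ.image g, ?_, ?_⟩
    · rw [Finset.card_image_of_injective _ hginj, Finset.card_univ, icount,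
        Set.ncard_eq_toFinset_card', Set.toFinset_card]
    · intro x hx
      obtain ⟨y, -, rfl⟩ := Finset.mem_image.1 hx
      rw [hg]
      exact y.2.2
  rw [← hTcard]
  set k := T.card with hk
  set m := (k - 1) / d with hm
  have hkm : k ≤ d * m + d := by
    have := Nat.lt_div_mul_add (a := k - 1) (b := d) (by omega)
    rw [← hm, mul_comm] at this
    omega
  have hroot : (max m 1 : ℕ) ≤ X ^ (1 / (d : ℝ)) := by
    rcases Nat.eq_zero_or_pos m with h0 | hmpos
    · rw [h0]
      simpa using Real.one_le_rpow hX1 (by positivity)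
    · rw [max_eq_left hmpos]
      have hdm : d * m ≤ k - 1 := Nat.mul_div_le _ _
      have hlt : ∀ i : Fin (d + 1), (i : ℕ) * m < k := fun i => by
        have h1 : (i : ℕ) * m ≤ d * m := Nat.mul_le_mul_right m (Nat.lt_succ_iff.1 i.2)
        have h2 : 1 ≤ d * m := Nat.mul_pos hp hmpos
        omega
      set e := T.orderEmbOfFin hk.symm with he
      have hsep : ∀ i j : Fin (d + 1), i < j →
          (m : ℤ) ≤ e ⟨j * m, hlt j⟩ - e ⟨i * m, hlt i⟩ := by
        intro i j hij
        have hle : (i : ℕ) * m + m ≤ j * m := by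
          rw [← Nat.succ_mul]
          exact Nat.mul_le_mul_right m hij
        have h := sub_le_sub_of_strictMono e.strictMono
          (i := ⟨i * m, hlt i⟩) (j := ⟨j * m, hlt j⟩) (Fin.mk_le_mk.2 (by omega))
        refine le_trans ?_ h
        simp only
        omega
      have hpow := pow_le_of_eval_mem_Ioc hd.symm hp hmpos (fun i => e ⟨i * m, hlt i⟩)
        (fun i j hij => by
          rcases lt_or_gt_of_ne hij with h | h
          · rw [abs_sub_comm]
            exact (hsep i j h).trans (le_abs_self _)
          · exact (hsep j i h).trans (le_abs_self _))
        (fun i => hT _ (T.orderEmbOfFin_mem hk.symm _))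
      rw [one_div, Real.le_rpow_inv_iff_of_pos (by positivity) (by positivity)
        (by exact_mod_cast hp), Real.rpow_natCast]
      exact hpow
  calc (k : ℝ) ≤ 2 * d * (max m 1 : ℕ) := by
        have : k ≤ 2 * d * max m 1 := by
          have h1 : d * m ≤ d * max m 1 := Nat.mul_le_mul_left d (le_max_left _ _)
          have h2 : d * 1 ≤ d * max m 1 := Nat.mul_le_mul_left d (le_max_right _ _)
          rw [mul_assoc]
          omega
        exact_mod_cast this
    _ ≤ _ := by gcongr

/-- The values of a nonconstant polynomial of degree `d` at `1, …, n` form a set of at least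
`n / d` elements. -/
theorem le_natDegree_mul_card_image_eval {p : Polynomial ℤ} (hp : 1 ≤ p.natDegree) (n : ℕ) :
    n ≤ p.natDegree * ((Finset.Icc (1 : ℤ) n).image fun x => p.eval x).card := by
  classical
  have h := Finset.card_le_mul_card_image (f := fun x => p.eval x) (Finset.Icc (1 : ℤ) n)
    p.natDegree fun b _ => by
      have h0 : p - Polynomial.C b ≠ 0 := fun h => by
        rw [sub_eq_zero] at h
        rw [h, Polynomial.natDegree_C] at hp
        omega
      rw [← Polynomial.natDegree_sub_C (a := b)]
      refine Polynomial.card_le_degree_of_subset_roots fun x hx => ?_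
      rw [Polynomial.mem_roots h0]
      have := (Finset.mem_filter.1 (Finset.mem_def.2 hx)).2
      simpa [sub_eq_zero] using this
  simpa using h

theorem abs_eval_le_mul_pow (p : Polynomial ℤ) {x n : ℤ} (hx : |x| ≤ n) (hn : 1 ≤ n) :
    |p.eval x| ≤ (∑ i ∈ Finset.range (p.natDegree + 1), |p.coeff i|) * n ^ p.natDegree := by
  rw [Polynomial.eval_eq_sum_range, Finset.sum_mul]
  refine (Finset.abs_sum_le_sum_abs _ _).trans (Finset.sum_le_sum fun i hi => ?_)
  rw [abs_mul, abs_pow]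
  have h1 : |x| ^ i ≤ n ^ i := pow_le_pow_left₀ (abs_nonneg x) hx i
  have h2 : n ^ i ≤ n ^ p.natDegree :=
    pow_le_pow_right₀ hn (Nat.lt_succ_iff.1 (Finset.mem_range.1 hi))
  exact mul_le_mul_of_nonneg_left (h1.trans h2) (abs_nonneg _)

theorem exists_frequently_le_icount_range_eval {p : Polynomial ℤ} (hp : 1 ≤ p.natDegree) :
    ∃ c : ℝ, 0 < c ∧ ∃ᶠ q in intervalFilter,
      c * ((q.2 - q.1 : ℤ) : ℝ) ^ (1 / (p.natDegree : ℝ)) ≤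
        (icount (Set.range fun n : ℤ => p.eval n) q.1 q.2 : ℝ) := by
  classical
  set d := p.natDegree with hd
  have hd0 : (0 : ℝ) < d := by exact_mod_cast hp
  set A : ℤ := ∑ i ∈ Finset.range (d + 1), |p.coeff i| with hA
  have hA0 : 0 ≤ A := Finset.sum_nonneg fun i _ => abs_nonneg _
  have hB0 : (0 : ℝ) < 2 * ((A : ℝ) + 1) := by
    have : (0 : ℝ) ≤ A := by exact_mod_cast hA0
    positivity
  set r : ℝ := (2 * ((A : ℝ) + 1)) ^ (1 / (d : ℝ)) with hr
  have hr0 : 0 < r := Real.rpow_pos_of_pos hB0 _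
  have htend : Tendsto (fun n : ℕ => (-((A + 1) * (n : ℤ) ^ d), (A + 1) * (n : ℤ) ^ d))
      atTop intervalFilter := by
    refine tendsto_comap_iff.2 (tendsto_atTop_mono (fun n => ?_) tendsto_natCast_atTop_atTop)
    simp only [Function.comp_apply]
    have h1 : (n : ℤ) ≤ (n : ℤ) ^ d := by exact_mod_cast Nat.le_self_pow (by omega) n
    nlinarith [Int.natCast_nonneg n]
  refine ⟨1 / (d * r), by positivity, htend.frequently (Eventually.frequently ?_)⟩
  filter_upwards [eventually_ge_atTop 1] with n hn
  have hlen : (((A + 1) * (n : ℤ) ^ d - -((A + 1) * (n : ℤ) ^ d) : ℤ) : ℝ) ^ (1 / (d : ℝ)) =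
      r * n := by
    have : (((A + 1) * (n : ℤ) ^ d - -((A + 1) * (n : ℤ) ^ d) : ℤ) : ℝ) =
        2 * ((A : ℝ) + 1) * (n : ℝ) ^ d := by
      push_cast
      ring
    rw [this, Real.mul_rpow hB0.le (by positivity), one_div,
      Real.pow_rpow_inv_natCast (by positivity) (by omega), hr, one_div]
  have hsub : (((Finset.Icc (1 : ℤ) n).image fun x => p.eval x : Finset ℤ) : Set ℤ) ⊆
      (Set.range fun n : ℤ => p.eval n) ∩
        Set.Ioc (-((A + 1) * (n : ℤ) ^ d)) ((A + 1) * (n : ℤ) ^ d) := by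
    intro y hy
    obtain ⟨x, hx, rfl⟩ := Finset.mem_image.1 (Finset.mem_coe.1 hy)
    rw [Finset.mem_Icc] at hx
    have h := abs_eval_le_mul_pow p (x := x) (n := n)
      (by rw [abs_of_pos (by linarith)]; exact hx.2) (by exact_mod_cast hn)
    rw [← hd, ← hA] at h
    have hpos : (0 : ℤ) < (n : ℤ) ^ d := pow_pos (by exact_mod_cast hn) _
    have h' := abs_le.1 h
    exact ⟨⟨x, rfl⟩, by linarith [h'.1], by linarith [h'.2]⟩
  have hcard := Set.ncard_le_ncard hsub ((Set.finite_Ioc _ _).subset Set.inter_subset_right)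
  rw [Set.ncard_coe_finset] at hcard
  have hn' : (n : ℝ) ≤ d * (icount (Set.range fun n : ℤ => p.eval n)
      (-((A + 1) * (n : ℤ) ^ d)) ((A + 1) * (n : ℤ) ^ d) : ℝ) := by
    exact_mod_cast (le_natDegree_mul_card_image_eval hp n).trans (Nat.mul_le_mul_left d hcard)
  rw [hlen]
  calc 1 / (d * r) * (r * n) = n / d := by field_simp
    _ ≤ _ := by rwa [div_le_iff₀ hd0, mul_comm]

/-- **Polynomial subsets of `ℤ`.** If `p ∈ ℤ[x]` has degree `d ≥ 1` and
`E = {p(n) : n ∈ ℤ}`, then `D(E) = 1/d` and `0 < H_{1/d}(E) < ∞`; in particular `E`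
is regular. -/
theorem polynomial_subset_regular (p : Polynomial ℤ) (hp : 1 ≤ p.natDegree) :
    countingDim (Set.range fun n : ℤ => p.eval n) = 1 / (p.natDegree : ℝ) ∧
    0 < countingMeasure (1 / (p.natDegree : ℝ)) (Set.range fun n : ℤ => p.eval n) ∧
    countingMeasure (1 / (p.natDegree : ℝ)) (Set.range fun n : ℤ => p.eval n) < ⊤ ∧
    Regular (Set.range fun n : ℤ => p.eval n) := by
  obtain ⟨c, hc, hlb⟩ := exists_frequently_le_icount_range_eval hp
  have hub := fun (M N : ℤ) (h : M < N) => icount_range_eval_le hp h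
  have hdim := countingDim_eq_of_bounds (by positivity) hc hub hlb
  have hpos := countingMeasure_pos_of_frequently hc hlb
  have htop := countingMeasure_lt_top_of_bound hub
  refine ⟨hdim, hpos, htop, ?_⟩
  rw [Regular, hdim]
  exact ⟨hpos, htop⟩
end
end

section
/- Let Λ ⊂ (0,∞) be a compact interval, let z = (a,b) and z' = (a',b') be distinct points of ℤ², and let Λ_{z,z'} = {λ ∈ Λ : a + ⌊λb⌋ = a' + ⌊λb'⌋}. If Λ_{z,z'} ≠ ∅, then: (a) b ≠ b' and the Lebesgue measure of Λ_{z,z'} is at most 2/|b − b'|; and (b) min Λ · |b − b'| − 1 < |a − a'| < max Λ · |b − b'| + 1. -/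
open Filter MeasureTheory
open scoped ENNReal

noncomputable section

/-- If `a + ⌊x⌋ = a' + ⌊x'⌋`, then `a - a'` is within distance `1` of `x' - x`. -/
theorem abs_sub_sub_lt_one_of_add_floor_eq {x x' : ℝ} {a a' : ℤ}
    (h : a + ⌊x⌋ = a' + ⌊x'⌋) : |(x' - x) - ((a : ℝ) - a')| < 1 := by
  have h' : (a : ℝ) + ⌊x⌋ = a' + ⌊x'⌋ := by exact_mod_cast h
  rw [abs_lt]
  constructor <;>
    linarith [Int.floor_le x, Int.lt_floor_add_one x, Int.floor_le x', Int.lt_floor_add_one x']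

/-- The set of `l` with `|l * d - k| < 1` has measure at most `2 / |d|`. -/
theorem volume_abs_mul_sub_lt_one_le {d : ℝ} (hd : d ≠ 0) (k : ℝ) :
    volume {l : ℝ | |l * d - k| < 1} ≤ ENNReal.ofReal (2 / |d|) := by
  have hsub : {l : ℝ | |l * d - k| < 1} ⊆ Metric.ball (k / d) (1 / |d|) := by
    intro l hl
    rw [Metric.mem_ball, Real.dist_eq, lt_div_iff₀ (abs_pos.mpr hd), ← abs_mul, sub_mul,
      div_mul_cancel₀ k hd]
    exact hl
  refine (measure_mono hsub).trans_eq ?_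
  rw [Real.volume_ball, mul_one_div]

/-- **Lemma 4.1 (transversality).** Let `Λ = [u, v] ⊂ (0, ∞)` be a compact interval
and `z = (a, b) ≠ z' = (a', b')` points of `ℤ²`. If
`Λ_{z,z'} = {λ ∈ Λ : a + ⌊λ b⌋ = a' + ⌊λ b'⌋}` is nonempty, then `b ≠ b'`,
`m(Λ_{z,z'}) ≤ 2 / |b - b'|`, and
`u |b - b'| - 1 < |a - a'| < v |b - b'| + 1`. -/
theorem transversality (u v : ℝ) (hu : 0 < u) (huv : u ≤ v) (a b a' b' : ℤ)
    (hzz' : (a, b) ≠ (a', b'))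
    (hne : {l : ℝ | l ∈ Set.Icc u v ∧
      a + ⌊l * (b : ℝ)⌋ = a' + ⌊l * (b' : ℝ)⌋}.Nonempty) :
    b ≠ b' ∧
    volume {l : ℝ | l ∈ Set.Icc u v ∧ a + ⌊l * (b : ℝ)⌋ = a' + ⌊l * (b' : ℝ)⌋} ≤
      ENNReal.ofReal (2 / |(b : ℝ) - (b' : ℝ)|) ∧
    u * |(b : ℝ) - (b' : ℝ)| - 1 < |(a : ℝ) - (a' : ℝ)| ∧
    |(a : ℝ) - (a' : ℝ)| < v * |(b : ℝ) - (b' : ℝ)| + 1 := by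
  have key : ∀ l : ℝ, a + ⌊l * (b : ℝ)⌋ = a' + ⌊l * (b' : ℝ)⌋ →
      |l * ((b : ℝ) - b') - ((a' : ℝ) - a)| < 1 := fun l hl => by
    simpa only [mul_sub] using abs_sub_sub_lt_one_of_add_floor_eq hl.symm
  obtain ⟨l, ⟨hul, hlv⟩, hl⟩ := hne
  have hb : b ≠ b' := by
    rintro rfl
    exact hzz' (by rw [add_right_cancel hl])
  have hl0 : |l * ((b : ℝ) - b')| = l * |(b : ℝ) - b'| := by
    rw [abs_mul, abs_of_pos (hu.trans_le hul)]
  have hclose := (abs_abs_sub_abs_le _ _).trans_lt (key l hl)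
  rw [hl0, abs_sub_comm (a' : ℝ), abs_lt] at hclose
  have hu' := mul_le_mul_of_nonneg_right hul (abs_nonneg ((b : ℝ) - b'))
  have hv' := mul_le_mul_of_nonneg_right hlv (abs_nonneg ((b : ℝ) - b'))
  refine ⟨hb, ?_, by linarith, by linarith⟩
  have hd : (b : ℝ) - b' ≠ 0 := sub_ne_zero.mpr (by exact_mod_cast hb)
  exact (measure_mono fun x hx => key x hx.2).trans
    (volume_abs_mul_sub_lt_one_le hd ((a' : ℝ) - a))
end
end

section
/- Let E, F ⊆ ℤ be regular sets with D(E) = α and D(F) = β, let Λ ⊂ (0,∞) be a compact interval, and let (I_n)_{n≥1}, (J_n)_{n≥1} be sequences of intervals of ℤ with |I_n| ≍ |J_n| (each bounded by a constant multiple of the other, uniformly in n) and |I_n| → ∞. For λ ∈ Λ set N_n(λ) = #{((a,b),(a',b')) ∈ ((E ∩ I_n)×(F ∩ J_n))² : a + ⌊λb⌋ = a' + ⌊λb'⌋} and Δ_n = ∫_Λ N_n(λ) dλ. Then: (a) if α + β < 1, there is C > 0 with Δ_n ≤ C·|I_n|^{α+β} for all n; (b) if α + β > 1, there is C > 0 with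 Δ_n ≤ C·|I_n|^{2α+2β−1} for all n. -/
open Filter MeasureTheory
open scoped ENNReal

noncomputable section

lemma countingDim_nonneg (E : Set ℤ) : 0 ≤ countingDim E := by
  have hne : intervalFilter.NeBot := by
    refine Filter.NeBot.comap_of_surj inferInstance fun z => ⟨(0, z), by simp⟩
  refine Real.sInf_nonneg fun x hx => ?_
  have hx' : ∀ᶠ p in intervalFilter,
      Real.log (icount E p.1 p.2) / Real.log ((p.2 - p.1 : ℤ) : ℝ) ≤ x := hx
  obtain ⟨p, hp⟩ := hx'.exists
  refine le_trans ?_ hp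
  exact div_nonneg (Real.log_natCast_nonneg _) (Real.log_intCast_nonneg _)

lemma icount_le_length (E : Set ℤ) {M N : ℤ} (h : M < N) :
    (icount E M N : ℝ) ≤ ((N - M : ℤ) : ℝ) := by
  have h1 : icount E M N ≤ (Set.Ioc M N).ncard :=
    Set.ncard_le_ncard Set.inter_subset_right (Set.finite_Ioc M N)
  have h2 : (Set.Ioc M N).ncard = (N - M).toNat := by
    rw [← Finset.coe_Ioc, Set.ncard_coe_finset, Int.card_Ioc]
  have h3 : (icount E M N : ℤ) ≤ N - M := by omega
  exact_mod_cast h3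

/-- A regular set satisfies a uniform upper bound over all intervals. -/
lemma Regular.exists_icount_le {E : Set ℤ} (hE : Regular E) :
    ∃ K : ℝ, 0 < K ∧ ∀ M N : ℤ, M < N →
      (icount E M N : ℝ) ≤ K * ((N - M : ℤ) : ℝ) ^ countingDim E := by
  obtain ⟨K, hK, hKtop⟩ := exists_between hE.2
  have hev := Filter.eventually_lt_of_limsup_lt hK
  obtain ⟨t, ht, hsub⟩ := Filter.mem_comap.1 hev
  obtain ⟨L, hL⟩ := Filter.mem_atTop_sets.1 ht
  have hD := countingDim_nonneg E
  refine ⟨K.toReal + |(L : ℝ)| + 1, by positivity, fun M N hMN => ?_⟩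
  have hlen : (1 : ℝ) ≤ ((N - M : ℤ) : ℝ) := by
    exact_mod_cast (by omega : (1 : ℤ) ≤ N - M)
  have hpow : 1 ≤ ((N - M : ℤ) : ℝ) ^ countingDim E := Real.one_le_rpow hlen hD
  have hK0 : 0 ≤ K.toReal := ENNReal.toReal_nonneg
  have hL0 := abs_nonneg (L : ℝ)
  rcases le_or_gt L (N - M) with h | h
  · have h1 : ENNReal.ofReal ((icount E M N : ℝ) / ((N - M : ℤ) : ℝ) ^ countingDim E) < K :=
      hsub (a := (M, N)) (Set.mem_preimage.2 (hL _ h))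
    have h2 := (ENNReal.ofReal_le_iff_le_toReal hKtop.ne).1 h1.le
    rw [div_le_iff₀ (by positivity)] at h2
    nlinarith
  · have h1 := icount_le_length E hMN
    have h2 : ((N - M : ℤ) : ℝ) ≤ L := by exact_mod_cast h.le
    have h3 := le_abs_self (L : ℝ)
    nlinarith

/-- The pairs near `(x, y)`, weighted by the inverse of the distance in the second coordinate,
are controlled by a dyadic geometric sum. -/
lemma sum_inv_dist_le {α β K₁ K₂ : ℝ} (hK₁ : 0 ≤ K₁)
    {A B : Finset ℤ}
    (hA : ∀ M N : ℤ, M < N →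
      ((A ∩ Finset.Ioc M N).card : ℝ) ≤ K₁ * ((N - M : ℤ) : ℝ) ^ α)
    (hB : ∀ M N : ℤ, M < N →
      ((B ∩ Finset.Ioc M N).card : ℝ) ≤ K₂ * ((N - M : ℤ) : ℝ) ^ β)
    {W : ℕ} (hW : 1 ≤ W) {c d : ℤ} (hBcd : B ⊆ Finset.Ioc c d) (x y : ℤ) (hy : y ∈ B) :
    ∑ p ∈ A ×ˢ B with p.2 ≠ y ∧ (p.1 - x).natAbs ≤ W * (p.2 - y).natAbs,
        (1 / ((p.2 - y).natAbs : ℝ)) ≤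
      K₁ * K₂ * (8 * W : ℝ) ^ (α + β) *
        ∑ k ∈ Finset.range (Nat.log 2 (d - c).natAbs + 1), ((2 : ℝ) ^ (α + β - 1)) ^ k := by
  set S := {p ∈ A ×ˢ B | p.2 ≠ y ∧ (p.1 - x).natAbs ≤ W * (p.2 - y).natAbs} with hS
  have hmaps : ∀ p ∈ S, Nat.log 2 (p.2 - y).natAbs ∈
      Finset.range (Nat.log 2 (d - c).natAbs + 1) := by
    intro p hp
    simp only [hS, Finset.mem_filter, Finset.mem_product] at hp
    have h1 := Finset.mem_Ioc.1 (hBcd hp.1.2)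
    have h2 := Finset.mem_Ioc.1 (hBcd hy)
    rw [Finset.mem_range, Nat.lt_succ_iff]
    exact Nat.log_mono_right (by omega)
  rw [← Finset.sum_fiberwise_of_maps_to hmaps, Finset.mul_sum]
  refine Finset.sum_le_sum fun k _ => ?_
  have hk : (0 : ℝ) < 2 ^ k := by positivity
  have hcard : ((Finset.filter (fun p => Nat.log 2 (p.2 - y).natAbs = k) S).card : ℝ) ≤
      (K₁ * (8 * W * 2 ^ k : ℝ) ^ α) * (K₂ * (8 * W * 2 ^ k : ℝ) ^ β) := by
    set R : ℤ := W * 2 ^ (k + 2) with hR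
    have hRpos : 0 < R := by positivity
    have hlen : ∀ z : ℤ, (((z + R) - (z - R) : ℤ) : ℝ) = 8 * W * 2 ^ k := by
      intro z; rw [hR]; push_cast; ring
    have hsub : Finset.filter (fun p => Nat.log 2 (p.2 - y).natAbs = k) S ⊆
        (A ∩ Finset.Ioc (x - R) (x + R)) ×ˢ (B ∩ Finset.Ioc (y - R) (y + R)) := by
      intro p hp
      simp only [hS, Finset.mem_filter, Finset.mem_product] at hp
      obtain ⟨⟨⟨hpA, hpB⟩, hne, hWp⟩, hlog⟩ := hp
      have hlt : (p.2 - y).natAbs < 2 ^ (k + 1) := by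
        rw [← hlog]; exact Nat.lt_pow_succ_log_self (by norm_num) _
      have h1 : W * (p.2 - y).natAbs < W * 2 ^ (k + 1) := Nat.mul_lt_mul_of_pos_left hlt hW
      have h2 : (p.2 - y).natAbs ≤ W * (p.2 - y).natAbs := Nat.le_mul_of_pos_left _ hW
      have hR' : R = 2 * ((W * 2 ^ (k + 1) : ℕ) : ℤ) := by rw [hR]; push_cast; ring
      simp only [Finset.mem_product, Finset.mem_inter, Finset.mem_Ioc]
      refine ⟨⟨hpA, ?_, ?_⟩, hpB, ?_, ?_⟩ <;> omega
    have h1 := hA (x - R) (x + R) (by omega)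
    have h2 := hB (y - R) (y + R) (by omega)
    rw [hlen] at h1 h2
    calc ((Finset.filter (fun p => Nat.log 2 (p.2 - y).natAbs = k) S).card : ℝ)
        ≤ ((A ∩ Finset.Ioc (x - R) (x + R)).card : ℝ) *
            ((B ∩ Finset.Ioc (y - R) (y + R)).card : ℝ) := by
          rw [← Nat.cast_mul, ← Finset.card_product]
          exact_mod_cast Finset.card_le_card hsub
      _ ≤ _ := by gcongr
  have hterm : ∀ p ∈ Finset.filter (fun p => Nat.log 2 (p.2 - y).natAbs = k) S,
      1 / ((p.2 - y).natAbs : ℝ) ≤ 1 / 2 ^ k := by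
    intro p hp
    simp only [hS, Finset.mem_filter, Finset.mem_product] at hp
    obtain ⟨⟨⟨hpA, hpB⟩, hne, hWp⟩, hlog⟩ := hp
    have : 2 ^ k ≤ (p.2 - y).natAbs := by
      rw [← hlog]; exact Nat.pow_log_le_self 2 (by omega)
    gcongr
    exact_mod_cast this
  refine (Finset.sum_le_card_nsmul _ _ _ hterm).trans ?_
  rw [nsmul_eq_mul]
  refine (mul_le_mul_of_nonneg_right hcard (by positivity)).trans_eq ?_
  have hW0 : (0 : ℝ) < 8 * W := by positivity
  rw [← Real.rpow_natCast ((2 : ℝ) ^ (α + β - 1)) k, ← Real.rpow_mul (by norm_num), mul_comm _ (k : ℝ),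
    Real.rpow_mul (by norm_num), Real.rpow_natCast, Real.rpow_sub_one hk.ne',
    Real.rpow_add hk, Real.rpow_add hW0, Real.mul_rpow hW0.le hk.le, Real.mul_rpow hW0.le hk.le]
  ring

/-- The coincidence set of `l` for two pairs with distinct second coordinates is short. -/
lemma volume_real_coincidence_le {u v : ℝ} (hu : 0 < u) (huv : u ≤ v) {W : ℕ} (hW : v + 1 ≤ W)
    (x y x' y' : ℤ) :
    (volume.restrict (Set.Icc u v)).real {l : ℝ | x + ⌊l * (y : ℝ)⌋ = x' + ⌊l * (y' : ℝ)⌋} ≤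
      if y' = y then (if x' = x then v - u else 0) else
        if (x' - x).natAbs ≤ W * (y' - y).natAbs then 2 * (1 / ((y' - y).natAbs : ℝ)) else 0 := by
  rw [measureReal_restrict_apply' measurableSet_Icc]
  split_ifs with h1 h2 h3
  · refine (measureReal_mono Set.inter_subset_right (by simp)).trans_eq ?_
    rw [Real.volume_real_Icc_of_le huv]
  · subst h1
    have : {l : ℝ | x + ⌊l * (y' : ℝ)⌋ = x' + ⌊l * (y' : ℝ)⌋} = ∅ := by
      ext l
      simp only [Set.mem_ofPred_eq, add_left_inj, Set.mem_empty_iff_false, iff_false]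
      exact fun h => h2 h.symm
    rw [this]; simp
  all_goals
    have hpos : (0 : ℝ) < |((y' - y : ℤ) : ℝ)| := by
      rw [abs_pos]; exact_mod_cast sub_ne_zero.2 h1
    have hkey : ∀ l : ℝ, x + ⌊l * (y : ℝ)⌋ = x' + ⌊l * (y' : ℝ)⌋ →
        |l * ((y' - y : ℤ) : ℝ) + ((x' - x : ℤ) : ℝ)| ≤ 1 := by
      intro l hl
      have e : ((x : ℝ)) + (⌊l * (y : ℝ)⌋ : ℝ) = x' + (⌊l * (y' : ℝ)⌋ : ℝ) := by exact_mod_cast hl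
      have a1 := Int.floor_le (l * (y : ℝ))
      have a2 := Int.lt_floor_add_one (l * (y : ℝ))
      have a3 := Int.floor_le (l * (y' : ℝ))
      have a4 := Int.lt_floor_add_one (l * (y' : ℝ))
      rw [abs_le]; push_cast; constructor <;> linarith
  · have hsub : {l : ℝ | x + ⌊l * (y : ℝ)⌋ = x' + ⌊l * (y' : ℝ)⌋} ∩ Set.Icc u v ⊆
        Metric.closedBall (-((x' - x : ℤ) : ℝ) / ((y' - y : ℤ) : ℝ))
          (1 / |((y' - y : ℤ) : ℝ)|) := by
      rintro l ⟨hl, -⟩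
      have hne : ((y' - y : ℤ) : ℝ) ≠ 0 := abs_pos.1 hpos
      rw [Metric.mem_closedBall, Real.dist_eq, le_div_iff₀ hpos, ← abs_mul]
      rw [sub_mul, div_mul_cancel₀ _ hne, sub_neg_eq_add]
      exact hkey l hl
    refine (measureReal_mono hsub measure_closedBall_lt_top.ne).trans_eq ?_
    rw [Real.volume_real_closedBall (by positivity), Nat.cast_natAbs, Int.cast_abs]
  · have : {l : ℝ | x + ⌊l * (y : ℝ)⌋ = x' + ⌊l * (y' : ℝ)⌋} ∩ Set.Icc u v = ∅ := by
      refine Set.eq_empty_of_forall_notMem ?_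
      rintro l ⟨hl, hlu, hlv⟩
      apply h3
      have hk := hkey l hl
      have h5 : |((x' - x : ℤ) : ℝ)| ≤ W * |((y' - y : ℤ) : ℝ)| := by
        have b1 : |((x' - x : ℤ) : ℝ)| ≤ 1 + l * |((y' - y : ℤ) : ℝ)| := by
          have := abs_sub (l * ((y' - y : ℤ) : ℝ) + ((x' - x : ℤ) : ℝ)) (l * ((y' - y : ℤ) : ℝ))
          rw [add_sub_cancel_left, abs_mul, abs_of_pos (hu.trans_le hlu)] at this
          linarith
        have b2 : (1 : ℝ) ≤ |((y' - y : ℤ) : ℝ)| := by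
          exact_mod_cast Int.one_le_abs (sub_ne_zero.2 h1)
        nlinarith
      rw [← Int.cast_abs, ← Int.cast_abs, Int.abs_eq_natAbs, Int.abs_eq_natAbs] at h5
      exact_mod_cast h5
    simp [this]

/-- The integrated number of coincidences over a pair of intervals, bounded by the number of pairs
times a dyadic geometric sum. -/
lemma integral_coincidence_le {E F : Set ℤ} (hE : Regular E) (hF : Regular F) {u v : ℝ}
    (hu : 0 < u) (huv : u ≤ v) :
    ∃ C : ℝ, 0 < C ∧ ∀ a b c d : ℤ, a < b → c < d →
      (∫ l in Set.Icc u v,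
        ((Set.ncard {q : (ℤ × ℤ) × ℤ × ℤ |
          q.1.1 ∈ E ∩ Set.Ioc a b ∧ q.1.2 ∈ F ∩ Set.Ioc c d ∧
          q.2.1 ∈ E ∩ Set.Ioc a b ∧ q.2.2 ∈ F ∩ Set.Ioc c d ∧
          q.1.1 + ⌊l * (q.1.2 : ℝ)⌋ = q.2.1 + ⌊l * (q.2.2 : ℝ)⌋} : ℝ))) ≤
      C * (((b - a : ℤ) : ℝ) ^ countingDim E * ((d - c : ℤ) : ℝ) ^ countingDim F) *
        (1 + ∑ k ∈ Finset.range (Nat.log 2 (d - c).natAbs + 1),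
          ((2 : ℝ) ^ (countingDim E + countingDim F - 1)) ^ k) := by
  classical
  obtain ⟨K₁, hK₁, hEK⟩ := hE.exists_icount_le
  obtain ⟨K₂, hK₂, hFK⟩ := hF.exists_icount_le
  set α := countingDim E
  set β := countingDim F
  set W : ℕ := ⌈v + 1⌉₊
  have hvW : v + 1 ≤ W := Nat.le_ceil _
  have hW : 1 ≤ W := by
    have : (1 : ℝ) ≤ W := by linarith
    exact_mod_cast this
  set D := K₁ * K₂ * (8 * W : ℝ) ^ (α + β)
  have hD : 0 < D := by positivity
  refine ⟨K₁ * K₂ * (v - u + 2 * D), mul_pos (mul_pos hK₁ hK₂) (by linarith), ?_⟩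
  intro a b c d hab hcd
  set A := ((Set.finite_Ioc a b).inter_of_right E).toFinset with hAdef
  set B := ((Set.finite_Ioc c d).inter_of_right F).toFinset with hBdef
  have hmA : ∀ x, x ∈ A ↔ x ∈ E ∩ Set.Ioc a b := fun x => Set.Finite.mem_toFinset _
  have hmB : ∀ x, x ∈ B ↔ x ∈ F ∩ Set.Ioc c d := fun x => Set.Finite.mem_toFinset _
  have hA : ∀ M N : ℤ, M < N →
      ((A ∩ Finset.Ioc M N).card : ℝ) ≤ K₁ * ((N - M : ℤ) : ℝ) ^ α := by
    intro M N hMN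
    refine le_trans ?_ (hEK M N hMN)
    rw [← Set.ncard_coe_finset, Nat.cast_le]
    refine Set.ncard_le_ncard (fun x hx => ?_) ((Set.finite_Ioc M N).inter_of_right E)
    rw [Finset.mem_coe, Finset.mem_inter, hmA, Finset.mem_Ioc] at hx
    exact ⟨hx.1.1, hx.2⟩
  have hB : ∀ M N : ℤ, M < N →
      ((B ∩ Finset.Ioc M N).card : ℝ) ≤ K₂ * ((N - M : ℤ) : ℝ) ^ β := by
    intro M N hMN
    refine le_trans ?_ (hFK M N hMN)
    rw [← Set.ncard_coe_finset, Nat.cast_le]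
    refine Set.ncard_le_ncard (fun x hx => ?_) ((Set.finite_Ioc M N).inter_of_right F)
    rw [Finset.mem_coe, Finset.mem_inter, hmB, Finset.mem_Ioc] at hx
    exact ⟨hx.1.1, hx.2⟩
  have hAsub : A ⊆ Finset.Ioc a b := fun x hx => Finset.mem_Ioc.2 ((hmA x).1 hx).2
  have hBsub : B ⊆ Finset.Ioc c d := fun x hx => Finset.mem_Ioc.2 ((hmB x).1 hx).2
  set T := ∑ k ∈ Finset.range (Nat.log 2 (d - c).natAbs + 1), ((2 : ℝ) ^ (α + β - 1)) ^ k
  have hT : 0 ≤ T := by positivity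
  set S : (ℤ × ℤ) × ℤ × ℤ → Set ℝ := fun q =>
    {l : ℝ | q.1.1 + ⌊l * (q.1.2 : ℝ)⌋ = q.2.1 + ⌊l * (q.2.2 : ℝ)⌋} with hSdef
  have hSm : ∀ q, MeasurableSet (S q) := by
    intro q
    refine measurableSet_eq_fun ?_ ?_ <;> fun_prop
  have hncard : ∀ l : ℝ,
      ((Set.ncard {q : (ℤ × ℤ) × ℤ × ℤ |
          q.1.1 ∈ E ∩ Set.Ioc a b ∧ q.1.2 ∈ F ∩ Set.Ioc c d ∧
          q.2.1 ∈ E ∩ Set.Ioc a b ∧ q.2.2 ∈ F ∩ Set.Ioc c d ∧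
          q.1.1 + ⌊l * (q.1.2 : ℝ)⌋ = q.2.1 + ⌊l * (q.2.2 : ℝ)⌋} : ℝ)) =
      ∑ q ∈ (A ×ˢ B) ×ˢ (A ×ˢ B), (S q).indicator 1 l := by
    intro l
    have : {q : (ℤ × ℤ) × ℤ × ℤ |
          q.1.1 ∈ E ∩ Set.Ioc a b ∧ q.1.2 ∈ F ∩ Set.Ioc c d ∧
          q.2.1 ∈ E ∩ Set.Ioc a b ∧ q.2.2 ∈ F ∩ Set.Ioc c d ∧
          q.1.1 + ⌊l * (q.1.2 : ℝ)⌋ = q.2.1 + ⌊l * (q.2.2 : ℝ)⌋} =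
        (((A ×ˢ B) ×ˢ (A ×ˢ B)).filter (fun q => l ∈ S q) : Finset _) := by
      ext q
      simp only [hSdef, Set.mem_ofPred_eq, Finset.coe_filter, Finset.mem_product, hmA, hmB,
        and_assoc]
    rw [this, Set.ncard_coe_finset, Finset.card_filter]
    push_cast
    exact Finset.sum_congr rfl fun q _ => by simp [Set.indicator_apply]
  have hint : ∀ q ∈ (A ×ˢ B) ×ˢ (A ×ˢ B),
      Integrable ((S q).indicator (1 : ℝ → ℝ)) (volume.restrict (Set.Icc u v)) := fun q _ =>
    (integrable_const (1 : ℝ)).indicator (hSm q)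
  simp_rw [hncard]
  rw [integral_finsetSum _ hint, Finset.sum_product]
  have hinner : ∀ p ∈ A ×ˢ B,
      ∑ p' ∈ A ×ˢ B, ∫ l in Set.Icc u v, (S (p, p')).indicator (1 : ℝ → ℝ) l ≤
        (v - u + 2 * D) * (1 + T) := by
    rintro ⟨x, y⟩ hp
    rw [Finset.mem_product] at hp
    calc ∑ p' ∈ A ×ˢ B, ∫ l in Set.Icc u v, (S ((x, y), p')).indicator (1 : ℝ → ℝ) l
        ≤ ∑ p' ∈ A ×ˢ B, ((if p' = (x, y) then v - u else 0) +
            if p'.2 ≠ y ∧ (p'.1 - x).natAbs ≤ W * (p'.2 - y).natAbs then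
              2 * (1 / ((p'.2 - y).natAbs : ℝ)) else 0) := by
          refine Finset.sum_le_sum fun p' _ => ?_
          rw [integral_indicator_one (hSm _)]
          refine (volume_real_coincidence_le hu huv hvW x y p'.1 p'.2).trans_eq ?_
          by_cases h1 : p'.2 = y <;> simp [h1, Prod.ext_iff]
      _ = (v - u) + 2 * ∑ p ∈ A ×ˢ B with
            p.2 ≠ y ∧ (p.1 - x).natAbs ≤ W * (p.2 - y).natAbs,
              (1 / ((p.2 - y).natAbs : ℝ)) := by
          rw [Finset.sum_add_distrib, Finset.sum_ite_eq', if_pos (Finset.mem_product.2 hp),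
            ← Finset.sum_filter, Finset.mul_sum]
      _ ≤ (v - u) + 2 * (D * T) := by
          gcongr
          exact sum_inv_dist_le hK₁.le hA hB hW hBsub x y hp.2
      _ ≤ (v - u + 2 * D) * (1 + T) := by
          have := mul_nonneg (sub_nonneg.2 huv) hT
          nlinarith
  refine (Finset.sum_le_card_nsmul _ _ _ hinner).trans ?_
  rw [nsmul_eq_mul, Finset.card_product]
  push_cast
  have h1 := hA a b hab
  have h2 := hB c d hcd
  rw [Finset.inter_eq_left.2 hAsub] at h1
  rw [Finset.inter_eq_left.2 hBsub] at h2
  have hvu : 0 ≤ v - u := sub_nonneg.2 huv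
  calc (A.card : ℝ) * B.card * ((v - u + 2 * D) * (1 + T))
      ≤ (K₁ * ((b - a : ℤ) : ℝ) ^ α) * (K₂ * ((d - c : ℤ) : ℝ) ^ β) *
          ((v - u + 2 * D) * (1 + T)) := by
        gcongr
    _ = _ := by push_cast; ring

/-- A geometric sum of ratio `2 ^ s` with `s < 0` is bounded. -/
lemma sum_two_rpow_le_of_neg {s : ℝ} (hs : s < 0) (n : ℕ) :
    ∑ k ∈ Finset.range n, ((2 : ℝ) ^ s) ^ k ≤ (1 - (2 : ℝ) ^ s)⁻¹ := by
  have h1 : (2 : ℝ) ^ s < 1 := Real.rpow_lt_one_of_one_lt_of_neg (by norm_num) hs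
  have h0 : (0 : ℝ) ≤ (2 : ℝ) ^ s := by positivity
  rw [← tsum_geometric_of_lt_one h0 h1]
  exact (summable_geometric_of_lt_one h0 h1).sum_le_tsum _ fun k _ => by positivity

/-- A geometric sum of ratio `2 ^ s` with `s > 0` over `2 ^ k ≤ m` is comparable to `m ^ s`. -/
lemma sum_two_rpow_le_of_pos {s : ℝ} (hs : 0 < s) {m : ℕ} (hm : m ≠ 0) :
    ∑ k ∈ Finset.range (Nat.log 2 m + 1), ((2 : ℝ) ^ s) ^ k ≤
      (2 : ℝ) ^ s / ((2 : ℝ) ^ s - 1) * (m : ℝ) ^ s := by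
  have h1 : 1 < (2 : ℝ) ^ s := Real.one_lt_rpow (by norm_num) hs
  have h2 : ((2 : ℝ) ^ s) ^ Nat.log 2 m ≤ (m : ℝ) ^ s := by
    rw [← Real.rpow_natCast, ← Real.rpow_mul (by norm_num), mul_comm,
      Real.rpow_mul (by norm_num), Real.rpow_natCast]
    gcongr
    exact_mod_cast Nat.pow_log_le_self 2 hm
  rw [geom_sum_eq h1.ne', div_mul_eq_mul_div]
  have h3 : 0 < (2 : ℝ) ^ s - 1 := by linarith
  gcongr
  rw [pow_succ]
  nlinarith

/-- **Lemma 4.2.** Let `E, F ⊆ ℤ` be regular with `D(E) = α`, `D(F) = β`, let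
`Λ = [u, v] ⊂ (0, ∞)` be a compact interval and `I_n = (a_n, b_n]`, `J_n = (c_n, d_n]`
intervals of comparable lengths with `|I_n| → ∞`. With
`N_n(λ) = #{(z, z') ∈ ((E ∩ I_n) × (F ∩ J_n))² : a + ⌊λ b⌋ = a' + ⌊λ b'⌋}` and
`Δ_n = ∫_Λ N_n(λ) dλ`: if `α + β < 1` then `Δ_n ≪ |I_n|^{α+β}`, and if `α + β > 1`
then `Δ_n ≪ |I_n|^{2α+2β-1}`. -/
theorem integral_estimate (E F : Set ℤ) (hE : Regular E) (hF : Regular F) (α β : ℝ)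
    (hα : countingDim E = α) (hβ : countingDim F = β)
    (u v : ℝ) (hu : 0 < u) (huv : u ≤ v)
    (a b c d : ℕ → ℤ) (hab : ∀ n, a n < b n) (hcd : ∀ n, c n < d n)
    (hcomp : ∃ C : ℝ, 0 < C ∧ ∀ n,
      ((b n - a n : ℤ) : ℝ) ≤ C * ((d n - c n : ℤ) : ℝ) ∧
      ((d n - c n : ℤ) : ℝ) ≤ C * ((b n - a n : ℤ) : ℝ))
    (hlen : Filter.Tendsto (fun n => b n - a n) Filter.atTop Filter.atTop) :
    ((α + β < 1) →
      ∃ C : ℝ, 0 < C ∧ ∀ n : ℕ,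
        (∫ l in Set.Icc u v,
          ((Set.ncard {q : (ℤ × ℤ) × ℤ × ℤ |
              q.1.1 ∈ E ∩ Set.Ioc (a n) (b n) ∧ q.1.2 ∈ F ∩ Set.Ioc (c n) (d n) ∧
              q.2.1 ∈ E ∩ Set.Ioc (a n) (b n) ∧ q.2.2 ∈ F ∩ Set.Ioc (c n) (d n) ∧
              q.1.1 + ⌊l * (q.1.2 : ℝ)⌋ = q.2.1 + ⌊l * (q.2.2 : ℝ)⌋} : ℝ))) ≤
          C * ((b n - a n : ℤ) : ℝ) ^ (α + β)) ∧
    ((1 < α + β) →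
      ∃ C : ℝ, 0 < C ∧ ∀ n : ℕ,
        (∫ l in Set.Icc u v,
          ((Set.ncard {q : (ℤ × ℤ) × ℤ × ℤ |
              q.1.1 ∈ E ∩ Set.Ioc (a n) (b n) ∧ q.1.2 ∈ F ∩ Set.Ioc (c n) (d n) ∧
              q.2.1 ∈ E ∩ Set.Ioc (a n) (b n) ∧ q.2.2 ∈ F ∩ Set.Ioc (c n) (d n) ∧
              q.1.1 + ⌊l * (q.1.2 : ℝ)⌋ = q.2.1 + ⌊l * (q.2.2 : ℝ)⌋} : ℝ))) ≤
          C * ((b n - a n : ℤ) : ℝ) ^ (2 * α + 2 * β - 1)) := by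
  obtain ⟨C, hC, hbound⟩ := integral_coincidence_le hE hF hu huv
  obtain ⟨C', hC', hcomp⟩ := hcomp
  have hβ0 : 0 ≤ β := hβ ▸ countingDim_nonneg F
  rw [hα, hβ] at hbound
  have hpos : ∀ n, (0 : ℝ) < ((b n - a n : ℤ) : ℝ) := fun n => by
    exact_mod_cast sub_pos.2 (hab n)
  have hone : ∀ n, (1 : ℝ) ≤ ((b n - a n : ℤ) : ℝ) := fun n => by
    exact_mod_cast sub_pos.2 (hab n)
  have hposJ : ∀ n, (0 : ℝ) < ((d n - c n : ℤ) : ℝ) := fun n => by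
    exact_mod_cast sub_pos.2 (hcd n)
  have hprod : ∀ n, ((b n - a n : ℤ) : ℝ) ^ α * ((d n - c n : ℤ) : ℝ) ^ β ≤
      C' ^ β * ((b n - a n : ℤ) : ℝ) ^ (α + β) := by
    intro n
    have hI := hpos n
    have hJ := hposJ n
    calc ((b n - a n : ℤ) : ℝ) ^ α * ((d n - c n : ℤ) : ℝ) ^ β
        ≤ ((b n - a n : ℤ) : ℝ) ^ α * (C' * ((b n - a n : ℤ) : ℝ)) ^ β := by
          gcongr
          exact (hcomp n).2
      _ = C' ^ β * ((b n - a n : ℤ) : ℝ) ^ (α + β) := by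
          rw [Real.mul_rpow hC'.le hI.le, Real.rpow_add hI]
          ring
  constructor
  · intro hs
    have hr : (2 : ℝ) ^ (α + β - 1) < 1 :=
      Real.rpow_lt_one_of_one_lt_of_neg (by norm_num) (by linarith)
    have hr' : 0 < (1 - (2 : ℝ) ^ (α + β - 1))⁻¹ := inv_pos.2 (by linarith)
    refine ⟨C * C' ^ β * (1 + (1 - (2 : ℝ) ^ (α + β - 1))⁻¹), by positivity, fun n => ?_⟩
    refine (hbound _ _ _ _ (hab n) (hcd n)).trans ?_
    have hI := hpos n
    calc _ ≤ C * (C' ^ β * ((b n - a n : ℤ) : ℝ) ^ (α + β)) *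
          (1 + (1 - (2 : ℝ) ^ (α + β - 1))⁻¹) := by
          have hJ := hposJ n
          exact mul_le_mul (mul_le_mul_of_nonneg_left (hprod n) hC.le)
            (by gcongr; exact sum_two_rpow_le_of_neg (by linarith) _)
            (by positivity) (by positivity)
      _ = _ := by ring
  · intro hs
    have hs' : 0 < α + β - 1 := by linarith
    have hr : 1 < (2 : ℝ) ^ (α + β - 1) := Real.one_lt_rpow (by norm_num) hs'
    set G := (2 : ℝ) ^ (α + β - 1) / ((2 : ℝ) ^ (α + β - 1) - 1) with hG
    have hGpos : 0 < G := div_pos (by positivity) (by linarith)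
    refine ⟨C * C' ^ β * (1 + G * C' ^ (α + β - 1)), by positivity, fun n => ?_⟩
    refine (hbound _ _ _ _ (hab n) (hcd n)).trans ?_
    have hI := hpos n
    have hJ := hposJ n
    have hsum : 1 + ∑ k ∈ Finset.range (Nat.log 2 (d n - c n).natAbs + 1),
        ((2 : ℝ) ^ (α + β - 1)) ^ k ≤
          (1 + G * C' ^ (α + β - 1)) * ((b n - a n : ℤ) : ℝ) ^ (α + β - 1) := by
      have h1 := sum_two_rpow_le_of_pos hs' (m := (d n - c n).natAbs)
        (by have := hcd n; omega)
      rw [← hG, Nat.cast_natAbs, abs_of_pos (sub_pos.2 (hcd n))] at h1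
      have h2 : ((d n - c n : ℤ) : ℝ) ^ (α + β - 1) ≤
          C' ^ (α + β - 1) * ((b n - a n : ℤ) : ℝ) ^ (α + β - 1) := by
        rw [← Real.mul_rpow hC'.le hI.le]
        gcongr
        exact (hcomp n).2
      have h3 : 1 ≤ ((b n - a n : ℤ) : ℝ) ^ (α + β - 1) := Real.one_le_rpow (hone n) hs'.le
      have h4 := mul_le_mul_of_nonneg_left h2 hGpos.le
      linarith
    calc _ ≤ C * (C' ^ β * ((b n - a n : ℤ) : ℝ) ^ (α + β)) *
          ((1 + G * C' ^ (α + β - 1)) * ((b n - a n : ℤ) : ℝ) ^ (α + β - 1)) := by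
          exact mul_le_mul (mul_le_mul_of_nonneg_left (hprod n) hC.le) hsum
            (by positivity) (by positivity)
      _ = C * C' ^ β * (1 + G * C' ^ (α + β - 1)) *
          (((b n - a n : ℤ) : ℝ) ^ (α + β) * ((b n - a n : ℤ) : ℝ) ^ (α + β - 1)) := by ring
      _ = _ := by
          rw [← Real.rpow_add hI]
          ring_nf
end
end

section
/- There exist regular sets E, F ⊆ ℤ with D(E) + D(F) > 1 such that for every λ ∈ ℝ, the arithmetic sum E + ⌊λF⌋ = {a + ⌊λb⌋ : a ∈ E, b ∈ F} has zero upper-Banach density. (Hence the compatibility hypothesis cannot be removed from the Marstrand theorem for subsets of integers.) -/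
open Filter MeasureTheory
open scoped ENNReal

noncomputable section

/-- A rapidly increasing sequence of scales. -/
def scale : ℕ → ℤ
  | 0 => 2
  | k + 1 => scale k ^ 10

/-- The multiples of `scale k` in `[scale k, scale k ^ 3]`. -/
def block (k : ℕ) : Finset ℤ := (Finset.Icc 1 (scale k ^ 2)).image (scale k * ·)

/-- The union of the blocks whose index lies in the progression `r, r + 2, r + 4, …`. -/
def blockUnion (r : ℕ) : Set ℤ := {x | ∃ k, x ∈ block (2 * k + r)}

lemma scale_succ (k : ℕ) : scale (k + 1) = scale k ^ 10 := rfl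

lemma two_le_scale (k : ℕ) : 2 ≤ scale k := by
  induction k with
  | zero => simp [scale]
  | succ k ih =>
    rw [scale_succ]
    exact ih.trans (le_self_pow₀ (by linarith) (by norm_num))

lemma scale_pos (k : ℕ) : 0 < scale k := by linarith [two_le_scale k]

lemma strictMono_scale : StrictMono scale := by
  refine strictMono_nat_of_lt_succ fun k => ?_
  rw [scale_succ]
  exact lt_self_pow₀ (by linarith [two_le_scale k]) (by norm_num)

lemma lt_scale (k : ℕ) : (k : ℤ) < scale k := by
  induction k with
  | zero => simp [scale]
  | succ k ih =>
    have := strictMono_scale (Nat.lt_succ_self k)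
    push_cast
    grind

lemma two_mul_scale_pow_le (k : ℕ) : 2 * scale k ^ 3 ≤ scale (k + 1) := by
  have h := two_le_scale k
  have h3 : 0 < scale k ^ 3 := by positivity
  calc 2 * scale k ^ 3 ≤ scale k ^ 7 * scale k ^ 3 := by
        gcongr
        exact h.trans (le_self_pow₀ (by linarith) (by norm_num))
    _ = scale (k + 1) := by rw [scale_succ]; ring

lemma scale_le_of_mem_block {k : ℕ} {x : ℤ} (hx : x ∈ block k) : scale k ≤ x := by
  simp only [block, Finset.mem_image, Finset.mem_Icc] at hx
  obtain ⟨j, ⟨h1, h2⟩, rfl⟩ := hx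
  nlinarith [scale_pos k]

lemma le_of_mem_block {k n : ℕ} (hk : k ≤ n) {x : ℤ} (hx : x ∈ block k) : x ≤ scale n ^ 3 := by
  simp only [block, Finset.mem_image, Finset.mem_Icc] at hx
  obtain ⟨j, ⟨h1, h2⟩, rfl⟩ := hx
  have h := strictMono_scale.monotone hk
  calc scale k * j ≤ scale k * scale k ^ 2 := by
        gcongr
        exact (scale_pos k).le
    _ = scale k ^ 3 := by ring
    _ ≤ scale n ^ 3 := by
        gcongr
        exact (scale_pos k).le

lemma pos_of_mem_block {k : ℕ} {x : ℤ} (hx : x ∈ block k) : 0 < x :=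
  (scale_pos k).trans_le (scale_le_of_mem_block hx)

lemma scale_dvd_of_mem_block {k : ℕ} {x : ℤ} (hx : x ∈ block k) : scale k ∣ x := by
  simp only [block, Finset.mem_image] at hx
  obtain ⟨j, -, rfl⟩ := hx
  exact dvd_mul_right _ _

lemma card_block (k : ℕ) : ((block k).card : ℤ) = scale k ^ 2 := by
  rw [block, Finset.card_image_of_injective _ (mul_right_injective₀ (scale_pos k).ne')]
  simp [sq_nonneg]

/-- Distinct points of the blocks are separated by half the larger scale. -/
lemma scale_le_two_mul_abs_sub_of_le {i j : ℕ} (hij : i ≤ j) {x y : ℤ} (hx : x ∈ block i)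
    (hy : y ∈ block j) (hxy : x ≠ y) : scale j ≤ 2 * |x - y| := by
  rcases hij.eq_or_lt with rfl | hlt
  · have hd := (scale_dvd_of_mem_block hx).sub (scale_dvd_of_mem_block hy)
    have h := Int.le_of_dvd (abs_pos.2 (sub_ne_zero.2 hxy)) ((dvd_abs _ _).2 hd)
    linarith [abs_nonneg (x - y)]
  · obtain ⟨m, rfl⟩ : ∃ m, j = m + 1 := ⟨j - 1, by omega⟩
    have h1 := le_of_mem_block (Nat.lt_succ_iff.1 hlt) hx
    have h2 := scale_le_of_mem_block hy
    have h3 := two_mul_scale_pow_le m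
    have h4 := neg_abs_le (x - y)
    linarith

lemma scale_le_two_mul_abs_sub {i j n : ℕ} (hn : n ≤ i ∨ n ≤ j) {x y : ℤ} (hx : x ∈ block i)
    (hy : y ∈ block j) (hxy : x ≠ y) : scale n ≤ 2 * |x - y| := by
  rcases le_total i j with h | h
  · exact (strictMono_scale.monotone (by omega)).trans
      (scale_le_two_mul_abs_sub_of_le h hx hy hxy)
  · rw [abs_sub_comm]
    exact (strictMono_scale.monotone (by omega)).trans
      (scale_le_two_mul_abs_sub_of_le h hy hx hxy.symm)

lemma exists_forall_eq_of_subsingleton {α : Type*} [Inhabited α] {p : α → Prop}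
    (h : ∀ x y, p x → p y → x = y) : ∃ z, ∀ x, p x → x = z := by
  by_cases hp : ∃ z, p z
  · obtain ⟨z, hz⟩ := hp
    exact ⟨z, fun x hx => h x z hx hz⟩
  · exact ⟨default, fun x hx => (hp ⟨x, hx⟩).elim⟩

/-! ### Counting in intervals -/

lemma icount_le_card {S : Set ℤ} {M N : ℤ} {T : Finset ℤ}
    (h : ∀ x ∈ S, M < x → x ≤ N → x ∈ T) : icount S M N ≤ T.card := by
  rw [icount, ← Set.ncard_coe_finset]
  exact Set.ncard_le_ncard (fun x hx => h x hx.1 hx.2.1 hx.2.2) T.finite_toSet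

lemma icount_mono (S : Set ℤ) {M N M' N' : ℤ} (hM : M' ≤ M) (hN : N ≤ N') :
    icount S M N ≤ icount S M' N' :=
  Set.ncard_le_ncard (Set.inter_subset_inter_right _ (Set.Ioc_subset_Ioc hM hN))
    ((Set.finite_Ioc _ _).inter_of_right _)

lemma icount_add_le (S : Set ℤ) (M K N : ℤ) :
    icount S M N ≤ icount S M K + icount S K N := by
  refine le_trans (Set.ncard_le_ncard ?_ ?_) (Set.ncard_union_le _ _)
  · intro x ⟨hx, h1, h2⟩
    rcases le_or_gt x K with h | h
    · exact Or.inl ⟨hx, h1, h⟩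
    · exact Or.inr ⟨hx, h, h2⟩
  · exact ((Set.finite_Ioc _ _).inter_of_right _).union ((Set.finite_Ioc _ _).inter_of_right _)

lemma icount_le_mul {S : Set ℤ} {l : ℤ} {c : ℕ} (h : ∀ M, icount S M (M + l) ≤ c) (M : ℤ)
    (k : ℕ) : icount S M (M + k * l) ≤ k * c := by
  induction k with
  | zero => simp [icount]
  | succ k ih =>
    have h1 := icount_add_le S M (M + k * l) (M + k * l + l)
    have h2 := h (M + k * l)
    have h3 : M + ((k + 1 : ℕ) : ℤ) * l = M + k * l + l := by push_cast; ring
    rw [h3, add_mul, one_mul]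
    omega

/-- A bound for windows of one fixed length controls the density in all longer windows. -/
lemma icount_div_le {S : Set ℤ} {l : ℤ} (hl : 0 < l) {c : ℕ}
    (h : ∀ M, icount S M (M + l) ≤ c) {M N : ℤ} (hMN : l ≤ N - M) :
    (icount S M N : ℝ) / ((N - M : ℤ) : ℝ) ≤ 2 * c / l := by
  have hlR : (0 : ℝ) < l := by exact_mod_cast hl
  have hMNR : (l : ℝ) ≤ ((N - M : ℤ) : ℝ) := by exact_mod_cast hMN
  obtain ⟨q, hq⟩ := Int.eq_ofNat_of_zero_le (Int.ediv_nonneg (by linarith : 0 ≤ N - M) hl.le)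
  have hdiv := Int.mul_ediv_add_emod (N - M) l
  have hlt := Int.emod_lt_of_pos (N - M) hl
  have hnn := Int.emod_nonneg (N - M) hl.ne'
  rw [hq] at hdiv
  have h1 : icount S M N ≤ (q + 1) * c := by
    refine (icount_mono S le_rfl ?_).trans (icount_le_mul h M (q + 1))
    push_cast
    nlinarith
  have h1R : (icount S M N : ℝ) ≤ (q + 1) * c := by exact_mod_cast h1
  have h2R : (q : ℝ) * l ≤ ((N - M : ℤ) : ℝ) := by
    have : (q : ℤ) * l ≤ N - M := by nlinarith
    exact_mod_cast this
  rw [div_le_div_iff₀ (hlR.trans_le hMNR) hlR]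
  calc (icount S M N : ℝ) * l ≤ (q + 1) * c * l := by gcongr
    _ = c * (q * l + l) := by ring
    _ ≤ c * (((N - M : ℤ) : ℝ) + ((N - M : ℤ) : ℝ)) := by gcongr
    _ = 2 * c * ((N - M : ℤ) : ℝ) := by ring

lemma eventually_le_length (L : ℤ) : ∀ᶠ p : ℤ × ℤ in intervalFilter, L ≤ p.2 - p.1 :=
  tendsto_comap.eventually (eventually_ge_atTop L)

lemma tendsto_length :
    Tendsto (fun p : ℤ × ℤ => ((p.2 - p.1 : ℤ) : ℝ)) intervalFilter atTop :=
  tendsto_intCast_atTop_atTop.comp tendsto_comap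

instance : intervalFilter.NeBot := by
  refine Filter.comap_neBot fun t ht => ?_
  obtain ⟨x, hx⟩ := Filter.nonempty_of_mem ht
  exact ⟨(0, x), by simpa using hx⟩

lemma upperBanach_eq_zero {S : Set ℤ}
    (h : ∀ ε : ℝ, 0 < ε → ∃ (l : ℤ) (c : ℕ), 0 < l ∧ 2 * c / l < ε ∧
      ∀ M, icount S M (M + l) ≤ c) : upperBanach S = 0 := by
  refine Tendsto.limsup_eq ?_
  rw [Metric.tendsto_nhds]
  intro ε hε
  obtain ⟨l, c, hl, hlt, hc⟩ := h ε hε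
  filter_upwards [eventually_le_length l] with p hp
  have h0 : (0 : ℝ) ≤ ((p.2 - p.1 : ℤ) : ℝ) := by exact_mod_cast hl.le.trans hp
  rw [Real.dist_0_eq_abs, abs_of_nonneg (by positivity)]
  exact (icount_div_le hl hc hp).trans_lt hlt

/-! ### The sumset has density zero -/

lemma upperBanach_eq_zero_of_eventually {S : Set ℤ}
    (h : ∀ᶠ n in atTop, ∀ M, (icount S M (M + scale n ^ 8) : ℤ) ≤ 8 * scale n ^ 6) :
    upperBanach S = 0 := by
  refine upperBanach_eq_zero fun ε hε => ?_
  obtain ⟨m, hm⟩ := exists_nat_gt (16 / ε)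
  obtain ⟨n, hn, hmn⟩ := (h.and (eventually_ge_atTop m)).exists
  have hs := two_le_scale n
  refine ⟨scale n ^ 8, (8 * scale n ^ 6).toNat, by positivity, ?_, fun M => ?_⟩
  · have hcast : (((8 * scale n ^ 6).toNat : ℕ) : ℝ) = 8 * (scale n : ℝ) ^ 6 := by
      have : (((8 * scale n ^ 6).toNat : ℕ) : ℤ) = 8 * scale n ^ 6 :=
        Int.toNat_of_nonneg (by positivity)
      exact_mod_cast this
    have hsR : (2 : ℝ) ≤ scale n := by exact_mod_cast hs
    have hbig : 16 / ε < scale n := by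
      have h1 := lt_scale n
      have : (m : ℤ) < scale n := by omega
      exact hm.trans (by exact_mod_cast this)
    rw [hcast]
    push_cast
    rw [div_lt_iff₀ (by positivity)]
    rw [div_lt_iff₀ hε] at hbig
    have h6 : (0 : ℝ) < (scale n : ℝ) ^ 6 := by positivity
    have h2 : 16 < ε * (scale n : ℝ) ^ 2 := by nlinarith
    calc 2 * (8 * (scale n : ℝ) ^ 6) = 16 * (scale n : ℝ) ^ 6 := by ring
      _ < ε * (scale n : ℝ) ^ 2 * (scale n : ℝ) ^ 6 := by gcongr
      _ = ε * (scale n : ℝ) ^ 8 := by ring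
  · have := hn M
    omega

lemma mem_Icc_of_mem_block {k n : ℕ} (hk : k ≤ n) {x : ℤ} (hx : x ∈ block k) :
    x ∈ Finset.Icc 1 (scale n ^ 3) :=
  Finset.mem_Icc.2 ⟨pos_of_mem_block hx, le_of_mem_block hk hx⟩

lemma card_Icc_scale (n : ℕ) : ((Finset.Icc 1 (scale n ^ 3)).card : ℤ) = scale n ^ 3 := by
  have := scale_pos n
  simp only [Int.card_Icc, add_sub_cancel_right]
  exact Int.toNat_of_nonneg (by positivity)

lemma abs_floor_mul_sub_sub_lt (l : ℝ) (x y : ℤ) :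
    |((⌊l * x⌋ - ⌊l * y⌋ : ℤ) : ℝ) - l * (x - y)| < 1 := by
  have h1 := Int.floor_le (l * x)
  have h2 := Int.lt_floor_add_one (l * x)
  have h3 := Int.floor_le (l * y)
  have h4 := Int.lt_floor_add_one (l * y)
  push_cast
  rw [abs_lt]
  constructor <;> linarith

/-- For a large scale `s`, the gap `s ^ 10` beats every other length involved. -/
lemma gap_bounds {l s : ℝ} (h10 : 10 ≤ s) (hle : |l| ≤ s) (hge : 1 ≤ |l| * s) :
    2 * (|l| * s ^ 3 + s ^ 8 + 1) < s ^ 10 ∧ 2 * (s ^ 8 + s ^ 3 + 1) < |l| * s ^ 10 := by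
  have h3 : s ^ 3 ≤ s ^ 8 := pow_le_pow_right₀ (by linarith) (by norm_num)
  have h4 : s ^ 4 ≤ s ^ 8 := pow_le_pow_right₀ (by linarith) (by norm_num)
  have h1 : 1 ≤ s ^ 8 := one_le_pow₀ (by linarith)
  have h9 : 10 * s ^ 8 ≤ s ^ 9 := by
    calc 10 * s ^ 8 ≤ s * s ^ 8 := by gcongr
      _ = s ^ 9 := by ring
  have h10' : s ^ 9 ≤ s ^ 10 := pow_le_pow_right₀ (by linarith) (by norm_num)
  have ha : |l| * s ^ 3 ≤ s ^ 4 := by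
    calc |l| * s ^ 3 ≤ s * s ^ 3 := by gcongr
      _ = s ^ 4 := by ring
  have hb : s ^ 9 ≤ |l| * s ^ 10 := by
    calc s ^ 9 = 1 * s ^ 9 := by ring
      _ ≤ |l| * s * s ^ 9 := by gcongr
      _ = |l| * s ^ 10 := by ring
  constructor <;> linarith

lemma eventually_scale_large {l : ℝ} (hl : l ≠ 0) :
    ∀ᶠ n in atTop, 10 ≤ (scale n : ℝ) ∧ |l| ≤ scale n ∧ 1 ≤ |l| * scale n := by
  have ht : Tendsto (fun n => (scale n : ℝ)) atTop atTop :=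
    tendsto_intCast_atTop_atTop.comp
      (tendsto_atTop_mono (fun k => (lt_scale k).le) tendsto_natCast_atTop_atTop)
  filter_upwards [ht.eventually_ge_atTop 10, ht.eventually_ge_atTop |l|,
    ht.eventually_ge_atTop (1 / |l|)] with n h1 h2 h3
  refine ⟨h1, h2, ?_⟩
  rwa [div_le_iff₀' (abs_pos.2 hl)] at h3

lemma abs_sub_lt_of_mem_Icc {x y A : ℤ} (hx : x ∈ Finset.Icc 1 A) (hy : y ∈ Finset.Icc 1 A) :
    |x - y| < A := by
  rw [Finset.mem_Icc] at hx hy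
  rw [abs_lt]
  constructor <;> linarith

/-- If two sums `e + ⌊l f⌋` are close together and at least one of the summands lies in a block of
index larger than `n`, then the sums have a common summand. -/
lemma eq_or_eq_of_abs_sub_lt {l : ℝ} {n : ℕ}
    (hn : ∀ m ≥ n, 10 ≤ (scale m : ℝ) ∧ |l| ≤ scale m ∧ 1 ≤ |l| * scale m)
    {i i' j j' : ℕ} (hbig : n < 2 * i ∨ n < 2 * j + 1) {e e' f f' : ℤ}
    (he : e ∈ block (2 * i)) (he' : e' ∈ block (2 * i'))
    (hf : f ∈ block (2 * j + 1)) (hf' : f' ∈ block (2 * j' + 1))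
    (hclose : |(e + ⌊l * f⌋) - (e' + ⌊l * f'⌋)| < scale n ^ 8) : e = e' ∨ f = f' := by
  by_contra! hne
  obtain ⟨hee, hff⟩ := hne
  obtain ⟨m, hm⟩ : ∃ m, m + 1 = max (max (2 * i) (2 * i')) (max (2 * j + 1) (2 * j' + 1)) :=
    ⟨_, Nat.succ_pred_eq_of_pos (by omega)⟩
  have hnm : n ≤ m := by omega
  obtain ⟨h10, hle, hge⟩ := hn m hnm
  obtain ⟨hg1, hg2⟩ := gap_bounds h10 hle hge
  have hcl : |((e - e' : ℤ) : ℝ) + ((⌊l * f⌋ - ⌊l * f'⌋ : ℤ) : ℝ)| < (scale m : ℝ) ^ 8 := by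
    have h1 : scale n ^ 8 ≤ scale m ^ 8 :=
      pow_le_pow_left₀ (scale_pos n).le (strictMono_scale.monotone hnm) 8
    have h2 : |(e - e') + (⌊l * f⌋ - ⌊l * f'⌋)| < scale m ^ 8 := by
      refine lt_of_eq_of_lt ?_ (hclose.trans_le h1)
      congr 1
      ring
    exact_mod_cast h2
  have hfl := abs_floor_mul_sub_sub_lt l f f'
  set E : ℝ := ((e - e' : ℤ) : ℝ) with hE
  set G : ℝ := ((⌊l * f⌋ - ⌊l * f'⌋ : ℤ) : ℝ)
  have hmul : |l * ((f : ℝ) - f')| = |l| * ((|f - f'| : ℤ) : ℝ) := by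
    rw [abs_mul]; push_cast; rfl
  have hEabs : |E| = ((|e - e'| : ℤ) : ℝ) := by rw [hE, Int.cast_abs]
  have htri1 : |E| ≤ |E + G| + |G - l * ((f : ℝ) - f')| + |l * ((f : ℝ) - f')| := by
    have h1 := abs_sub (E + G) G
    have h2 := abs_add_le (G - l * ((f : ℝ) - f')) (l * ((f : ℝ) - f'))
    rw [add_sub_cancel_right] at h1
    rw [sub_add_cancel] at h2
    linarith
  have htri2 : |l * ((f : ℝ) - f')| ≤ |E + G| + |G - l * ((f : ℝ) - f')| + |E| := by
    have h1 := abs_sub (E + G) E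
    have h2 := abs_sub G (G - l * ((f : ℝ) - f'))
    rw [add_sub_cancel_left] at h1
    rw [sub_sub_cancel] at h2
    linarith
  rw [hmul, hEabs] at htri1 htri2
  rcases Nat.even_or_odd' (m + 1) with ⟨c, hc | hc⟩
  · have hfs : |f - f'| < scale m ^ 3 := abs_sub_lt_of_mem_Icc
      (mem_Icc_of_mem_block (by omega) hf) (mem_Icc_of_mem_block (by omega) hf')
    have hes : scale (m + 1) ≤ 2 * |e - e'| :=
      scale_le_two_mul_abs_sub (by omega) he he' hee
    rw [scale_succ] at hes
    have hfsR : ((|f - f'| : ℤ) : ℝ) ≤ (scale m : ℝ) ^ 3 := by exact_mod_cast hfs.le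
    have hesR : (scale m : ℝ) ^ 10 ≤ 2 * ((|e - e'| : ℤ) : ℝ) := by exact_mod_cast hes
    have := mul_le_mul_of_nonneg_left hfsR (abs_nonneg l)
    linarith
  · have hes : |e - e'| < scale m ^ 3 := abs_sub_lt_of_mem_Icc
      (mem_Icc_of_mem_block (by omega) he) (mem_Icc_of_mem_block (by omega) he')
    have hfs : scale (m + 1) ≤ 2 * |f - f'| :=
      scale_le_two_mul_abs_sub (by omega) hf hf' hff
    rw [scale_succ] at hfs
    have hesR : ((|e - e'| : ℤ) : ℝ) ≤ (scale m : ℝ) ^ 3 := by exact_mod_cast hes.le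
    have hfsR : (scale m : ℝ) ^ 10 ≤ 2 * ((|f - f'| : ℤ) : ℝ) := by exact_mod_cast hfs
    have := mul_le_mul_of_nonneg_left hfsR (abs_nonneg l)
    linarith

lemma abs_sub_lt_of_mem_Ioc {x y M L : ℤ} (hx : x ∈ Finset.Ioc M (M + L))
    (hy : y ∈ Finset.Ioc M (M + L)) : |x - y| < L := by
  rw [Finset.mem_Ioc] at hx hy
  rw [abs_lt]
  constructor <;> linarith

/-- A window of length `scale n ^ 8` contains at most one point from the blocks of index larger
than `n`. -/
lemma exists_eq_of_mem_window {r n : ℕ} (M : ℤ) :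
    ∃ z, ∀ x ∈ blockUnion r, x ∈ Finset.Ioc M (M + scale n ^ 8) →
      x ∈ insert z (Finset.Icc 1 (scale n ^ 3)) := by
  obtain ⟨z, hz⟩ := exists_forall_eq_of_subsingleton
    (p := fun x : ℤ => (∃ k > n, x ∈ block k) ∧ x ∈ Finset.Ioc M (M + scale n ^ 8)) (by
      rintro x y ⟨⟨k, hk, hx⟩, hxM⟩ ⟨⟨k', hk', hy⟩, hyM⟩
      by_contra hxy
      have h1 := abs_sub_lt_of_mem_Ioc hxM hyM
      have h2 : scale (n + 1) ≤ 2 * |x - y| := scale_le_two_mul_abs_sub (by omega) hx hy hxy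
      have h3 : 2 * scale n ^ 8 ≤ scale n ^ 10 := by
        have := two_le_scale n
        calc 2 * scale n ^ 8 ≤ scale n ^ 2 * scale n ^ 8 := by
              gcongr
              nlinarith
          _ = scale n ^ 10 := by ring
      rw [scale_succ] at h2
      linarith)
  refine ⟨z, fun x ⟨k, hx⟩ hxM => ?_⟩
  rcases le_or_gt (2 * k + r) n with h | h
  · exact Finset.mem_insert_of_mem (mem_Icc_of_mem_block h hx)
  · exact Finset.mem_insert.2 (Or.inl (hz x ⟨⟨_, h, hx⟩, hxM⟩))

/-- The same for the sets `⌊l F⌋`. -/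
lemma exists_eq_of_floor_mem_window {l : ℝ} {n : ℕ}
    (hn : ∀ m ≥ n, 10 ≤ (scale m : ℝ) ∧ |l| ≤ scale m ∧ 1 ≤ |l| * scale m) (M : ℤ) :
    ∃ z, ∀ x ∈ blockUnion 1, ⌊l * (x : ℝ)⌋ ∈ Finset.Ioc M (M + scale n ^ 8) →
      x ∈ insert z (Finset.Icc 1 (scale n ^ 3)) := by
  obtain ⟨h10, hle, hge⟩ := hn n le_rfl
  have hg := (gap_bounds h10 hle hge).2
  obtain ⟨z, hz⟩ := exists_forall_eq_of_subsingleton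
    (p := fun x : ℤ => (∃ k > n, x ∈ block k) ∧
      ⌊l * (x : ℝ)⌋ ∈ Finset.Ioc M (M + scale n ^ 8)) (by
      rintro x y ⟨⟨k, hk, hx⟩, hxM⟩ ⟨⟨k', hk', hy⟩, hyM⟩
      by_contra hxy
      have h1 := abs_sub_lt_of_mem_Ioc hxM hyM
      have h2 : scale (n + 1) ≤ 2 * |x - y| := scale_le_two_mul_abs_sub (by omega) hx hy hxy
      rw [scale_succ] at h2
      have h1R : |((⌊l * (x : ℝ)⌋ - ⌊l * (y : ℝ)⌋ : ℤ) : ℝ)| < (scale n : ℝ) ^ 8 := by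
        exact_mod_cast h1
      have h2R : (scale n : ℝ) ^ 10 ≤ 2 * ((|x - y| : ℤ) : ℝ) := by exact_mod_cast h2
      have hfl := abs_floor_mul_sub_sub_lt l x y
      have hmul : |l * ((x : ℝ) - y)| = |l| * ((|x - y| : ℤ) : ℝ) := by
        rw [abs_mul]; push_cast; rfl
      have htri := abs_sub ((⌊l * (x : ℝ)⌋ - ⌊l * (y : ℝ)⌋ : ℤ) : ℝ)
        (((⌊l * (x : ℝ)⌋ - ⌊l * (y : ℝ)⌋ : ℤ) : ℝ) - l * ((x : ℝ) - y))
      rw [sub_sub_cancel, hmul] at htri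
      have := mul_le_mul_of_nonneg_left h2R (abs_nonneg l)
      have h3 : (0 : ℝ) ≤ (scale n : ℝ) ^ 3 := by positivity
      linarith)
  refine ⟨z, fun x ⟨k, hx⟩ hxM => ?_⟩
  rcases le_or_gt (2 * k + 1) n with h | h
  · exact Finset.mem_insert_of_mem (mem_Icc_of_mem_block h hx)
  · exact Finset.mem_insert.2 (Or.inl (hz x ⟨⟨_, h, hx⟩, hxM⟩))

lemma card_insert_Icc_le (z : ℤ) (n : ℕ) :
    ((insert z (Finset.Icc 1 (scale n ^ 3))).card : ℤ) ≤ scale n ^ 3 + 1 := by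
  have h1 := Finset.card_insert_le z (Finset.Icc 1 (scale n ^ 3))
  have h2 := card_Icc_scale n
  omega

lemma scale_pow_three_add_one_le (n : ℕ) : scale n ^ 3 + 1 ≤ 2 * scale n ^ 6 := by
  have := two_le_scale n
  have h1 : scale n ^ 3 ≤ scale n ^ 6 := pow_le_pow_right₀ (by linarith) (by norm_num)
  have h2 : 1 ≤ scale n ^ 6 := one_le_pow₀ (by linarith)
  linarith

lemma upperBanach_sumFloor (l : ℝ) :
    upperBanach (sumFloor (blockUnion 0) (blockUnion 1) l) = 0 := by
  refine upperBanach_eq_zero_of_eventually ?_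
  rcases eq_or_ne l 0 with rfl | hl
  · refine Eventually.of_forall fun n M => ?_
    obtain ⟨z, hz⟩ := exists_eq_of_mem_window (r := 0) (n := n) M
    have h1 : icount (sumFloor (blockUnion 0) (blockUnion 1) 0) M (M + scale n ^ 8) ≤ _ :=
      icount_le_card (T := insert z (Finset.Icc 1 (scale n ^ 3))) (by
        rintro x ⟨e, he, f, hf, rfl⟩ h1 h2
        simp only [zero_mul, Int.floor_zero, add_zero] at h1 h2 ⊢
        exact hz e he (Finset.mem_Ioc.2 ⟨h1, h2⟩))
    have h2 := card_insert_Icc_le z n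
    have h3 := scale_pow_three_add_one_le n
    have h4 : 0 < scale n ^ 6 := pow_pos (scale_pos n) 6
    omega
  obtain ⟨n₀, hn₀⟩ := eventually_atTop.1 (eventually_scale_large hl)
  filter_upwards [eventually_ge_atTop n₀] with n hn M
  have hlarge : ∀ m ≥ n, 10 ≤ (scale m : ℝ) ∧ |l| ≤ scale m ∧ 1 ≤ |l| * scale m :=
    fun m hm => hn₀ m (hn.trans hm)
  have h4 : 0 < scale n ^ 6 := pow_pos (scale_pos n) 6
  by_cases hbig : ∃ i j : ℕ, (n < 2 * i ∨ n < 2 * j + 1) ∧ ∃ e ∈ block (2 * i),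
      ∃ f ∈ block (2 * j + 1), e + ⌊l * (f : ℝ)⌋ ∈ Finset.Ioc M (M + scale n ^ 8)
  · obtain ⟨i, j, hij, e, he, f, hf, hef⟩ := hbig
    obtain ⟨z, hz⟩ := exists_eq_of_mem_window (r := 0) (n := n) (M - ⌊l * (f : ℝ)⌋)
    obtain ⟨w, hw⟩ := exists_eq_of_floor_mem_window hlarge (M - e)
    have h1 : icount (sumFloor (blockUnion 0) (blockUnion 1) l) M (M + scale n ^ 8) ≤ _ :=
      icount_le_card (T := (insert z (Finset.Icc 1 (scale n ^ 3))).image (· + ⌊l * (f : ℝ)⌋) ∪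
        (insert w (Finset.Icc 1 (scale n ^ 3))).image (fun x : ℤ => e + ⌊l * (x : ℝ)⌋)) (by
        rintro x ⟨e', ⟨i', he'⟩, f', ⟨j', hf'⟩, rfl⟩ h1 h2
        rw [Finset.mem_union, Finset.mem_image, Finset.mem_image]
        rcases eq_or_eq_of_abs_sub_lt hlarge hij he he' hf hf'
          (abs_sub_lt_of_mem_Ioc hef (Finset.mem_Ioc.2 ⟨h1, h2⟩)) with rfl | rfl
        · refine Or.inr ⟨f', hw f' ⟨j', hf'⟩ (Finset.mem_Ioc.2 ⟨?_, ?_⟩), rfl⟩ <;> linarith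
        · refine Or.inl ⟨e', hz e' ⟨i', he'⟩ (Finset.mem_Ioc.2 ⟨?_, ?_⟩), rfl⟩ <;> linarith)
    have h5 := h1.trans (Finset.card_union_le _ _)
    have h6 := h5.trans (add_le_add Finset.card_image_le Finset.card_image_le)
    have h7 := card_insert_Icc_le z n
    have h8 := card_insert_Icc_le w n
    have h3 := scale_pow_three_add_one_le n
    omega
  · have h1 : icount (sumFloor (blockUnion 0) (blockUnion 1) l) M (M + scale n ^ 8) ≤ _ :=
      icount_le_card (T := (Finset.Icc 1 (scale n ^ 3) ×ˢ Finset.Icc 1 (scale n ^ 3)).image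
        (fun p : ℤ × ℤ => p.1 + ⌊l * (p.2 : ℝ)⌋)) (by
        rintro x ⟨e, ⟨i, he⟩, f, ⟨j, hf⟩, rfl⟩ h1 h2
        have hsmall : ¬ (n < 2 * i ∨ n < 2 * j + 1) := fun h =>
          hbig ⟨i, j, h, e, he, f, hf, Finset.mem_Ioc.2 ⟨h1, h2⟩⟩
        refine Finset.mem_image.2 ⟨(e, f), Finset.mem_product.2 ⟨?_, ?_⟩, rfl⟩
        · exact mem_Icc_of_mem_block (by omega) he
        · exact mem_Icc_of_mem_block (by omega) hf)
    have h5 := h1.trans Finset.card_image_le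
    rw [Finset.card_product] at h5
    have h6 : (icount (sumFloor (blockUnion 0) (blockUnion 1) l) M (M + scale n ^ 8) : ℤ) ≤
        scale n ^ 3 * scale n ^ 3 := by
      rw [← card_Icc_scale n]
      exact_mod_cast h5
    have h7 : scale n ^ 3 * scale n ^ 3 = scale n ^ 6 := by ring
    linarith

/-! ### Regularity -/

lemma exists_scale_le_lt {L : ℤ} (hL : scale 1 ≤ L) :
    ∃ m, scale (m + 1) ≤ L ∧ L < scale (m + 2) := by
  by_contra! h
  have hall : ∀ m, scale (m + 1) ≤ L := fun m => by
    induction m with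
    | zero => exact hL
    | succ m ih => exact h m ih
  have h1 := hall L.toNat
  have h2 := lt_scale (L.toNat + 1)
  push_cast at h2
  have h3 := Int.self_le_toNat L
  linarith

lemma card_filter_dvd_Ioc_le {a M N : ℤ} (ha : 0 < a) (hMN : M ≤ N) :
    a * (((Finset.Ioc M N).filter (a ∣ ·)).card : ℤ) ≤ N - M + a := by
  have haQ : (0 : ℚ) < a := by exact_mod_cast ha
  rw [Int.Ioc_filter_dvd_card M N ha, mul_max_of_nonneg _ _ ha.le]
  refine max_le ?_ (by linarith)
  have h1 : (⌊N / (a : ℚ)⌋ : ℚ) * a ≤ N := (le_div_iff₀ haQ).1 (Int.floor_le _)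
  have h2 : (M : ℚ) < (⌊M / (a : ℚ)⌋ + 1) * a := (div_lt_iff₀ haQ).1 (Int.lt_floor_add_one _)
  have h3 : (a : ℚ) * (⌊N / (a : ℚ)⌋ - ⌊M / (a : ℚ)⌋) ≤ N - M + a := by linarith
  exact_mod_cast h3

lemma cube_le_of_le_sq_of_mul_le {a t L : ℝ} (ha : 0 < a) (ht : 0 ≤ t)
    (haL : a ≤ 2 * L) (h1 : t ≤ a ^ 2) (h2 : a * t ≤ L + a) : t ^ 3 ≤ 9 * L ^ 2 := by
  have h3 : (a * t) ^ 2 ≤ (3 * L) ^ 2 := pow_le_pow_left₀ (by positivity) (by linarith) 2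
  calc t ^ 3 = t * t ^ 2 := by ring
    _ ≤ a ^ 2 * t ^ 2 := by gcongr
    _ = (a * t) ^ 2 := by ring
    _ ≤ (3 * L) ^ 2 := h3
    _ = 9 * L ^ 2 := by ring

lemma le_three_mul_rpow {t L : ℝ} (hL : 0 ≤ L) (h : t ^ 3 ≤ 9 * L ^ 2) :
    t ≤ 3 * L ^ (2 / 3 : ℝ) := by
  have h1 : (L ^ (2 / 3 : ℝ)) ^ 3 = L ^ 2 := by
    rw [← Real.rpow_natCast, ← Real.rpow_mul hL]
    norm_num
  by_contra! hlt
  have h2 : (3 * L ^ (2 / 3 : ℝ)) ^ 3 < t ^ 3 := pow_lt_pow_left₀ hlt (by positivity) (by norm_num)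
  rw [mul_pow, h1] at h2
  nlinarith [sq_nonneg L]

lemma icount_blockUnion_le (r : ℕ) {M N : ℤ} (hMN : scale 1 ≤ N - M) :
    (icount (blockUnion r) M N : ℝ) ≤ 9 * ((N - M : ℤ) : ℝ) ^ (2 / 3 : ℝ) := by
  have hs1 := two_le_scale 1
  obtain ⟨m, hm1, hm2⟩ := exists_scale_le_lt (by linarith : scale 1 ≤ 2 * (N - M))
  obtain ⟨z, hz⟩ := exists_forall_eq_of_subsingleton
    (p := fun x : ℤ => (∃ k > m + 1, x ∈ block k) ∧ M < x ∧ x ≤ N) (by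
      rintro x y ⟨⟨k, hk, hx⟩, hx1, hx2⟩ ⟨⟨k', hk', hy⟩, hy1, hy2⟩
      by_contra hxy
      have h2 : scale (m + 2) ≤ 2 * |x - y| := scale_le_two_mul_abs_sub (by omega) hx hy hxy
      have h3 : |x - y| < N - M := by
        rw [abs_lt]
        constructor <;> linarith
      linarith)
  set B := (block (m + 1)).filter (· ∈ Finset.Ioc M N) with hB
  have hcount : icount (blockUnion r) M N ≤ _ :=
    icount_le_card (T := Finset.Icc 1 (scale m ^ 3) ∪ (B ∪ {z})) (by
      rintro x ⟨k, hx⟩ h1 h2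
      rw [Finset.mem_union, Finset.mem_union, Finset.mem_singleton]
      rcases lt_trichotomy (2 * k + r) (m + 1) with h | h | h
      · exact Or.inl (mem_Icc_of_mem_block (by omega) hx)
      · rw [h] at hx
        exact Or.inr (Or.inl (Finset.mem_filter.2 ⟨hx, Finset.mem_Ioc.2 ⟨h1, h2⟩⟩))
      · exact Or.inr (Or.inr (hz x ⟨⟨_, h, hx⟩, h1, h2⟩)))
  have hcount2 : icount (blockUnion r) M N ≤ (Finset.Icc 1 (scale m ^ 3)).card + (B.card + 1) :=
    (hcount.trans (Finset.card_union_le _ _)).trans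
      (Nat.add_le_add_left (Finset.card_union_le _ _) _)
  have hcountR : (icount (blockUnion r) M N : ℝ) ≤ (scale m : ℝ) ^ 3 + (B.card + 1) := by
    have h1 := card_Icc_scale m
    have : (icount (blockUnion r) M N : ℤ) ≤ scale m ^ 3 + (B.card + 1) := by omega
    exact_mod_cast this
  have hB1 : (B.card : ℤ) ≤ scale (m + 1) ^ 2 := by
    rw [← card_block]
    exact_mod_cast Finset.card_filter_le _ _
  have hB2 : scale (m + 1) * (B.card : ℤ) ≤ N - M + scale (m + 1) := by
    refine le_trans ?_ (card_filter_dvd_Ioc_le (scale_pos (m + 1)) (by linarith : M ≤ N))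
    refine mul_le_mul_of_nonneg_left ?_ (scale_pos _).le
    norm_cast
    refine Finset.card_le_card fun x hx => ?_
    rw [hB, Finset.mem_filter] at hx
    exact Finset.mem_filter.2 ⟨hx.2, scale_dvd_of_mem_block hx.1⟩
  set L : ℝ := ((N - M : ℤ) : ℝ) with hL
  have hL2 : 2 ≤ L := by
    have : 2 ≤ N - M := by linarith
    rw [hL]
    exact_mod_cast this
  have hmL : (scale m : ℝ) ^ 10 ≤ 2 * L := by
    rw [scale_succ] at hm1
    rw [hL]
    exact_mod_cast hm1
  have hsm : (2 : ℝ) ≤ scale m := by exact_mod_cast two_le_scale m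
  have t1 : (scale m : ℝ) ^ 3 ≤ 3 * L ^ (2 / 3 : ℝ) := by
    refine le_three_mul_rpow (by linarith) ?_
    calc ((scale m : ℝ) ^ 3) ^ 3 = (scale m : ℝ) ^ 9 := by ring
      _ ≤ (scale m : ℝ) ^ 10 := pow_le_pow_right₀ (by linarith) (by norm_num)
      _ ≤ 9 * L ^ 2 := by nlinarith
  have t2 : (B.card : ℝ) ≤ 3 * L ^ (2 / 3 : ℝ) := by
    refine le_three_mul_rpow (by linarith) ?_
    refine cube_le_of_le_sq_of_mul_le (a := (scale (m + 1) : ℝ)) ?_ (by positivity)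
      ?_ ?_ ?_
    · exact_mod_cast scale_pos (m + 1)
    · rw [hL]; exact_mod_cast hm1
    · exact_mod_cast hB1
    · rw [hL]; exact_mod_cast hB2
  have t3 : (1 : ℝ) ≤ 3 * L ^ (2 / 3 : ℝ) := le_three_mul_rpow (by linarith) (by nlinarith)
  linarith

lemma frequently_le_icount_blockUnion (r : ℕ) :
    ∃ᶠ p : ℤ × ℤ in intervalFilter, 1 < p.2 - p.1 ∧
      ((p.2 - p.1 : ℤ) : ℝ) ^ (2 / 3 : ℝ) ≤ icount (blockUnion r) p.1 p.2 := by
  have ht : Tendsto (fun k : ℕ => ((0 : ℤ), scale (2 * k + r) ^ 3)) atTop intervalFilter := by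
    rw [intervalFilter, tendsto_comap_iff]
    refine tendsto_atTop_mono (fun k => ?_) tendsto_natCast_atTop_atTop
    have h1 := lt_scale (2 * k + r)
    have h2 : scale (2 * k + r) ≤ scale (2 * k + r) ^ 3 :=
      le_self_pow₀ (by linarith [two_le_scale (2 * k + r)]) (by norm_num)
    push_cast at h1
    simp only [Function.comp_apply, sub_zero]
    linarith
  refine ht.frequently (Eventually.of_forall fun k => ?_).frequently
  have hs := two_le_scale (2 * k + r)
  set a := scale (2 * k + r) with ha
  refine ⟨?_, ?_⟩
  · simpa using one_lt_pow₀ (by linarith : 1 < a) (by norm_num : 3 ≠ 0)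
  · have h1 : (((a ^ 3 - 0 : ℤ)) : ℝ) ^ (2 / 3 : ℝ) = (a : ℝ) ^ 2 := by
      have h0 : (0 : ℝ) ≤ a := by exact_mod_cast (by linarith : 0 ≤ a)
      push_cast
      rw [sub_zero, ← Real.rpow_natCast, ← Real.rpow_mul h0, ← Real.rpow_natCast]
      norm_num
    have h2 : (block (2 * k + r)).card ≤ icount (blockUnion r) 0 (a ^ 3) := by
      rw [icount, ← Set.ncard_coe_finset]
      refine Set.ncard_le_ncard (fun x hx => ⟨⟨k, hx⟩, pos_of_mem_block hx, ?_⟩)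
        ((Set.finite_Ioc _ _).inter_of_right _)
      exact le_of_mem_block le_rfl hx
    have h3 : a ^ 2 ≤ (icount (blockUnion r) 0 (a ^ 3) : ℤ) := by
      rw [ha, ← card_block]
      exact_mod_cast h2
    rw [h1]
    exact_mod_cast h3

lemma log_icount_div_le {c : ℕ} {L C α ε : ℝ} (hC : 0 < C) (hL : 1 < L) (hα : 0 ≤ α + ε)
    (hc : (c : ℝ) ≤ C * L ^ α) (hε : Real.log C ≤ ε * Real.log L) :
    Real.log c / Real.log L ≤ α + ε := by
  rw [div_le_iff₀ (Real.log_pos hL)]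
  rcases c.eq_zero_or_pos with rfl | hpos
  · simpa using mul_nonneg hα (Real.log_pos hL).le
  · have h1 : Real.log c ≤ Real.log (C * L ^ α) :=
      Real.log_le_log (by exact_mod_cast hpos) hc
    rw [Real.log_mul hC.ne' (by positivity), Real.log_rpow (by linarith)] at h1
    linarith

/-- A set whose counting function is `O(L ^ α)`, with the order attained along arbitrarily long
intervals, has counting dimension `α`. -/
lemma countingDim_eq {S : Set ℤ} {α C : ℝ} (hα : 0 ≤ α) (hC : 0 < C)
    (hle : ∀ᶠ p : ℤ × ℤ in intervalFilter,
      (icount S p.1 p.2 : ℝ) ≤ C * ((p.2 - p.1 : ℤ) : ℝ) ^ α)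
    (hge : ∃ᶠ p : ℤ × ℤ in intervalFilter, 1 < p.2 - p.1 ∧
      ((p.2 - p.1 : ℤ) : ℝ) ^ α ≤ icount S p.1 p.2) : countingDim S = α := by
  have hup : ∀ ε : ℝ, 0 < ε → ∀ᶠ p : ℤ × ℤ in intervalFilter,
      Real.log (icount S p.1 p.2) / Real.log ((p.2 - p.1 : ℤ) : ℝ) ≤ α + ε := by
    intro ε hε
    have hlog := (Real.tendsto_log_atTop.comp tendsto_length).eventually_ge_atTop
      (Real.log C / ε)
    filter_upwards [hle, hlog, tendsto_length.eventually_gt_atTop 1] with p h1 h2 h3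
    refine log_icount_div_le hC h3 (by linarith) h1 ?_
    rwa [div_le_iff₀' hε] at h2
  have hnonneg : ∀ᶠ p : ℤ × ℤ in intervalFilter,
      0 ≤ Real.log (icount S p.1 p.2) / Real.log ((p.2 - p.1 : ℤ) : ℝ) := by
    filter_upwards [tendsto_length.eventually_gt_atTop 1] with p h
    exact div_nonneg (Real.log_natCast_nonneg _) (Real.log_pos h).le
  refine le_antisymm (le_of_forall_pos_le_add fun ε hε => ?_) ?_
  · exact limsup_le_of_le (isCoboundedUnder_le_of_eventually_le _ hnonneg) (hup ε hε)
  · refine le_limsup_of_frequently_le (hge.mono fun p hp => ?_)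
      (isBoundedUnder_of_eventually_le (hup 1 one_pos))
    have hL : (1 : ℝ) < ((p.2 - p.1 : ℤ) : ℝ) := by exact_mod_cast hp.1
    rw [le_div_iff₀ (Real.log_pos hL), ← Real.log_rpow (by linarith)]
    exact Real.log_le_log (by positivity) hp.2

lemma regular_of_eventually_le_of_frequently_ge {S : Set ℤ} {α C : ℝ} (hα : 0 ≤ α) (hC : 0 < C)
    (hle : ∀ᶠ p : ℤ × ℤ in intervalFilter,
      (icount S p.1 p.2 : ℝ) ≤ C * ((p.2 - p.1 : ℤ) : ℝ) ^ α)
    (hge : ∃ᶠ p : ℤ × ℤ in intervalFilter, 1 < p.2 - p.1 ∧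
      ((p.2 - p.1 : ℤ) : ℝ) ^ α ≤ icount S p.1 p.2) : Regular S := by
  rw [Regular, countingDim_eq hα hC hle hge]
  constructor
  · refine one_pos.trans_le (le_limsup_of_frequently_le (hge.mono fun p hp => ?_))
    have hL : (0 : ℝ) < ((p.2 - p.1 : ℤ) : ℝ) := by exact_mod_cast one_pos.trans hp.1
    rw [ENNReal.one_le_ofReal, one_le_div (by positivity)]
    exact hp.2
  · refine (limsup_le_of_le (a := ENNReal.ofReal C) (by isBoundedDefault) ?_).trans_lt
      ENNReal.ofReal_lt_top
    filter_upwards [hle, tendsto_length.eventually_gt_atTop 0] with p h1 h2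
    refine ENNReal.ofReal_le_ofReal ?_
    rwa [div_le_iff₀ (by positivity)]

lemma eventually_icount_blockUnion_le (r : ℕ) : ∀ᶠ p : ℤ × ℤ in intervalFilter,
    (icount (blockUnion r) p.1 p.2 : ℝ) ≤ 9 * ((p.2 - p.1 : ℤ) : ℝ) ^ (2 / 3 : ℝ) := by
  filter_upwards [eventually_le_length (scale 1)] with p hp
  exact icount_blockUnion_le r hp

lemma countingDim_blockUnion (r : ℕ) : countingDim (blockUnion r) = 2 / 3 :=
  countingDim_eq (by norm_num) (by norm_num) (eventually_icount_blockUnion_le r)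
    (frequently_le_icount_blockUnion r)

lemma regular_blockUnion (r : ℕ) : Regular (blockUnion r) :=
  regular_of_eventually_le_of_frequently_ge (by norm_num) (by norm_num)
    (eventually_icount_blockUnion_le r) (frequently_le_icount_blockUnion r)

/-- **Subsection 4.3 counterexample.** There are regular sets `E, F ⊆ ℤ` with
`D(E) + D(F) > 1` such that `E + ⌊λ F⌋` has zero upper-Banach density for every
`λ ∈ ℝ`; hence compatibility cannot be removed from the Marstrand theorem. -/
theorem counterexample_non_compatible :
    ∃ E F : Set ℤ, Regular E ∧ Regular F ∧ 1 < countingDim E + countingDim F ∧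
      ∀ l : ℝ, upperBanach (sumFloor E F l) = 0 := by
  refine ⟨blockUnion 0, blockUnion 1, regular_blockUnion 0, regular_blockUnion 1, ?_,
    upperBanach_sumFloor⟩
  rw [countingDim_blockUnion, countingDim_blockUnion]
  norm_num
end
end
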